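/- Let ξ ∈ h*/ℤR have zero central charge and be integral, i.e. λ(h) ∈ ℤ for all λ ∈ ξ. Then for i, j ∈ ℤ with i > j one has Ext¹_O(L(i h✓), L(j h✓)) ≅ ℂ if (i ≠ 0 and j = i - 1) or (i ≥ 0 and j = -i - 2), and Ext¹_O(L(i h✓), L(j h✓)) = 0 otherwise; moreover Ext¹_O(L(i h✓), L(j h✓)) ≅ Ext¹_O(L(j h✓), L(i h✓)) for all i, j ∈ ℤ. -/

import Mathlib

set_option maxSynthPendingDepth 3

namespace Schrodinger

noncomputable section

open scoped TensorProduct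

/-- Generators of the Schrödinger algebra. -/
inductive Gen : Type
  | E | H | F | P | Q | Z
  deriving DecidableEq

/-- The free algebra on the generators. -/
abbrev FA : Type := FreeAlgebra ℂ Gen

/-- Inclusion of generators. -/
def ιg (g : Gen) : FA := FreeAlgebra.ι ℂ g

/-- The defining relations of the universal enveloping algebra of the Schrödinger
algebra `s`: `z` is central and `[h,e]=2e`, `[e,f]=h`, `[h,f]=-2f`, `[e,q]=p`,
`[e,p]=0`, `[h,p]=p`, `[f,p]=q`, `[f,q]=0`, `[h,q]=-q`, `[p,q]=z`. -/
inductive Rel : FA → FA → Prop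
  | he : Rel (ιg .H * ιg .E) (ιg .E * ιg .H + 2 * ιg .E)
  | ef : Rel (ιg .E * ιg .F) (ιg .F * ιg .E + ιg .H)
  | hf : Rel (ιg .H * ιg .F) (ιg .F * ιg .H - 2 * ιg .F)
  | eq : Rel (ιg .E * ιg .Q) (ιg .Q * ιg .E + ιg .P)
  | ep : Rel (ιg .E * ιg .P) (ιg .P * ιg .E)
  | hp : Rel (ιg .H * ιg .P) (ιg .P * ιg .H + ιg .P)
  | fp : Rel (ιg .F * ιg .P) (ιg .P * ιg .F + ιg .Q)
  | fq : Rel (ιg .F * ιg .Q) (ιg .Q * ιg .F)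
  | hq : Rel (ιg .H * ιg .Q) (ιg .Q * ιg .H - ιg .Q)
  | pq : Rel (ιg .P * ιg .Q) (ιg .Q * ιg .P + ιg .Z)
  | ze : Rel (ιg .Z * ιg .E) (ιg .E * ιg .Z)
  | zh : Rel (ιg .Z * ιg .H) (ιg .H * ιg .Z)
  | zf : Rel (ιg .Z * ιg .F) (ιg .F * ιg .Z)
  | zp : Rel (ιg .Z * ιg .P) (ιg .P * ιg .Z)
  | zq : Rel (ιg .Z * ιg .Q) (ιg .Q * ιg .Z)

/-- The universal enveloping algebra `U = U(s)` of the Schrödinger algebra,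
presented by generators and relations (via the PBW theorem). -/
abbrev U : Type := RingQuot Rel

/-- The generators of `U`. -/
def gen (g : Gen) : U := RingQuot.mkAlgHom ℂ Rel (ιg g)

def E : U := gen .E
def H : U := gen .H
def F : U := gen .F
def P : U := gen .P
def Q : U := gen .Q
def Z : U := gen .Z

/-- Scalars inside `U`. -/
def sc (a : ℂ) : U := algebraMap ℂ U a

/-- The Casimir element `c = (h² + h + 4fe)z − 2(fp² − eq² − hpq)`. -/
def cElt : U := (H * H + H + 4 * (F * E)) * Z - 2 * (F * (P * P) - E * (Q * Q) - H * (P * Q))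

/-- The left ideal of `U` defining the Verma module `Δ(λ)` for
`λ ∈ 𝔥*` with `λ(h) = hh`, `λ(z) = zz`:  it is generated by `n₊ = span{e,p}`
together with `h - λ(h)` and `z - λ(z)`; then
`Δ(λ) = U ⊗_{U(𝔟)} ℂ_λ ≅ U / U(e, p, h - λ(h), z - λ(z))`. -/
def vermaIdeal (hh zz : ℂ) : Submodule U U :=
  Submodule.span U ({E, P, H - sc hh, Z - sc zz} : Set U)

/-- The Verma module `Δ(λ)` with highest weight `λ`, `λ(h) = hh`, `λ(z) = zz`. -/
abbrev Verma (hh zz : ℂ) : Type := U ⧸ vermaIdeal hh zz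

/-- The canonical highest weight generator `v_λ` of `Δ(λ)`. -/
def hwVec (hh zz : ℂ) : Verma hh zz := Submodule.Quotient.mk 1

/-- The unique maximal submodule `K(λ)` of `Δ(λ)`. -/
def vermaRad (hh zz : ℂ) : Submodule U (Verma hh zz) := sSup {N : Submodule U (Verma hh zz) | N ≠ ⊤}

/-- The simple highest weight module `L(λ) = Δ(λ)/K(λ)`. -/
abbrev SimpleHW (hh zz : ℂ) : Type := Verma hh zz ⧸ vermaRad hh zz

/-- The scalar `ϑ_λ = (λ(h)² + 3λ(h) + 2)·λ(z)` by which the Casimir element `c`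
acts on the Verma module `Δ(λ)`. -/
def vartheta (hh zz : ℂ) : ℂ := (hh ^ 2 + 3 * hh + 2) * zz

end

end Schrodinger

namespace Schrodinger

noncomputable section

open CategoryTheory

/-- The `ℂ`-vector space structure on a `U`-module, obtained by restricting
scalars along `ℂ → U`. -/
def cmod (M : Type) [AddCommGroup M] [Module U M] : Module ℂ M :=
  Module.compHom M (algebraMap ℂ U)

/-- `v` is a weight vector of weight `λ` with `λ(h) = hh` and `λ(z) = zz`. -/
def IsWeightVec {M : Type} [AddCommGroup M] [Module U M] (hh zz : ℂ) (v : M) : Prop :=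
  H • v = sc hh • v ∧ Z • v = sc zz • v

/-- The subalgebra `U(n₊)` of `U` generated by `n₊ = span{e, p}`. -/
def nPlus : Subalgebra ℂ U := Algebra.adjoin ℂ ({E, P} : Set U)

/-- Membership in category `O`: finitely generated, a (direct) sum of its
weight spaces, and locally `U(n₊)`-finite. -/
def InO (M : Type) [AddCommGroup M] [Module U M] : Prop :=
  Module.Finite U M ∧
  (∀ v : M, v ∈ AddSubgroup.closure {w : M | ∃ hh zz : ℂ, IsWeightVec hh zz w}) ∧
  (letI := cmod M
   ∀ v : M, ∃ W : Submodule ℂ M, FiniteDimensional ℂ W ∧ ∀ u ∈ nPlus, u • v ∈ W)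

/-- Membership in the block `O[ξ]`, where `ξ ∈ 𝔥*/ℤR` is the class of the weight
`(hh0, zz0)` (so that the weights in `ξ` are exactly `(hh0 + n, zz0)`, `n ∈ ℤ`):
the module is in `O` and all its weights lie in `ξ`. -/
def InBlock (hh0 zz0 : ℂ) (M : ModuleCat.{0} U) : Prop :=
  InO M ∧
  ∀ (v : M) (hh zz : ℂ), v ≠ 0 → IsWeightVec hh zz v → zz = zz0 ∧ ∃ n : ℤ, hh = hh0 + n

/-- The Verma module as an object of the category of `U`-modules. -/
def VermaC (hh zz : ℂ) : ModuleCat.{0} U := ModuleCat.of U (Verma hh zz)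

/-- `Pc` is a Serre class inside the subcategory (of the category of `U`-modules)
cut out by `Oc`: it is contained in `Oc`, closed under isomorphism, and for every
short exact sequence `0 → N → M → M/N → 0` in `Oc`, `M` belongs to `Pc` if and only
if both `N` and `M/N` do. -/
def SerreClassIn (Oc Pc : ModuleCat.{0} U → Prop) : Prop :=
  (∀ M, Pc M → Oc M) ∧
  (∀ M N : ModuleCat.{0} U, Nonempty ((M : Type) ≃ₗ[U] (N : Type)) → Pc M → Oc N → Pc N) ∧
  (∀ (M : ModuleCat.{0} U) (N : Submodule U M), Oc M →
      (Pc M ↔ Pc (ModuleCat.of U N) ∧ Pc (ModuleCat.of U ((M : Type) ⧸ N))))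

/-- Membership in the Serre subcategory of the subcategory cut out by `Oc`
generated by the set of objects `S`. -/
def InSerreGen (Oc : ModuleCat.{0} U → Prop) (S : Set (ModuleCat.{0} U))
    (M : ModuleCat.{0} U) : Prop :=
  Oc M ∧ ∀ Pc : ModuleCat.{0} U → Prop, SerreClassIn Oc Pc → (∀ X ∈ S, Pc X) → Pc M

end

end Schrodinger

namespace Schrodinger

open CategoryTheory

noncomputable section

/-- An extension `0 → B → X → A → 0` in category `O` (so with middle term an
object of `O`). -/
structure OExt (A B : ModuleCat.{0} U) : Type 1 where
  X : ModuleCat.{0} U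
  memO : InO X
  incl : (B : Type) →ₗ[U] (X : Type)
  proj : (X : Type) →ₗ[U] (A : Type)
  inj : Function.Injective incl
  surj : Function.Surjective proj
  exact : LinearMap.range incl = LinearMap.ker proj

/-- The extension splits. -/
def OExt.Split {A B : ModuleCat.{0} U} (Ex : OExt A B) : Prop :=
  ∃ s : (A : Type) →ₗ[U] Ex.X, Ex.proj ∘ₗ s = LinearMap.id

/-- `Ext¹_O(A, B) = 0`: every extension of `A` by `B` in `O` splits. -/
def ExtIsZero (A B : ModuleCat.{0} U) : Prop := ∀ Ex : OExt A B, Ex.Split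

/-- `Ext¹_O(A, B) ≅ ℂ`: there exists a non-split extension of `A` by `B` in
`O`, and any two non-split extensions are proportional, i.e. related by an
isomorphism of the middle terms commuting with the projections and restricting
to a nonzero scalar on `B` (this says exactly that all nonzero classes in
`Ext¹` lie on one line). -/
def ExtIsOneDimensional (A B : ModuleCat.{0} U) : Prop :=
  (∃ Ex : OExt A B, ¬ Ex.Split) ∧
  ∀ E1 E2 : OExt A B, ¬ E1.Split → ¬ E2.Split →
    ∃ (c : ℂ), c ≠ 0 ∧ ∃ ψ : (E1.X : Type) ≃ₗ[U] (E2.X : Type),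
      (∀ b : (B : Type), ψ (E1.incl b) = E2.incl (sc c • b)) ∧
      (∀ x : (E1.X : Type), E2.proj (ψ x) = E1.proj x)

/-- The simple highest weight module `L(i·h✓)` (of zero central charge) as an
object of the category of `U`-modules. -/
def Lmod (i : ℤ) : ModuleCat.{0} U := ModuleCat.of U (SimpleHW (i : ℂ) 0)

/-! ### Generators and relations in `U` -/

section Relations

theorem mkAlgHom_eq_of_rel {a b : FA} (h : Rel a b) :
    RingQuot.mkAlgHom ℂ Rel a = RingQuot.mkAlgHom ℂ Rel b := RingQuot.mkAlgHom_rel ℂ h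

theorem mkAlgHom_two : RingQuot.mkAlgHom ℂ Rel (2 : FA) = 2 := map_ofNat _ 2

theorem H_mul_E : H * E = E * H + 2 * E := by
  simpa [E, H, gen, mkAlgHom_two] using mkAlgHom_eq_of_rel Rel.he

theorem E_mul_F : E * F = F * E + H := by
  simpa [E, F, H, gen] using mkAlgHom_eq_of_rel Rel.ef

theorem H_mul_F : H * F = F * H - 2 * F := by
  simpa [F, H, gen, mkAlgHom_two] using mkAlgHom_eq_of_rel Rel.hf

theorem E_mul_Q : E * Q = Q * E + P := by
  simpa [E, P, Q, gen] using mkAlgHom_eq_of_rel Rel.eq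

theorem E_mul_P : E * P = P * E := by
  simpa [E, P, gen] using mkAlgHom_eq_of_rel Rel.ep

theorem H_mul_P : H * P = P * H + P := by
  simpa [H, P, gen] using mkAlgHom_eq_of_rel Rel.hp

theorem F_mul_P : F * P = P * F + Q := by
  simpa [F, P, Q, gen] using mkAlgHom_eq_of_rel Rel.fp

theorem F_mul_Q : F * Q = Q * F := by
  simpa [F, Q, gen] using mkAlgHom_eq_of_rel Rel.fq

theorem H_mul_Q : H * Q = Q * H - Q := by
  simpa [H, Q, gen] using mkAlgHom_eq_of_rel Rel.hq

theorem P_mul_Q : P * Q = Q * P + Z := by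
  simpa [P, Q, Z, gen] using mkAlgHom_eq_of_rel Rel.pq

theorem Z_mul_gen (g : Gen) : Z * gen g = gen g * Z := by
  cases g with
  | E => simpa [Z, gen] using mkAlgHom_eq_of_rel Rel.ze
  | H => simpa [Z, gen] using mkAlgHom_eq_of_rel Rel.zh
  | F => simpa [Z, gen] using mkAlgHom_eq_of_rel Rel.zf
  | P => simpa [Z, gen] using mkAlgHom_eq_of_rel Rel.zp
  | Q => simpa [Z, gen] using mkAlgHom_eq_of_rel Rel.zq
  | Z => rfl

/-- The generators generate `U` as a `ℂ`-algebra. -/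
@[elab_as_elim]
theorem U_induction {motive : U → Prop} (algebraMap : ∀ r, motive (algebraMap ℂ U r))
    (gen : ∀ g, motive (gen g)) (mul : ∀ a b, motive a → motive b → motive (a * b))
    (add : ∀ a b, motive a → motive b → motive (a + b)) (u : U) : motive u := by
  obtain ⟨a, rfl⟩ := RingQuot.mkAlgHom_surjective ℂ Rel u
  induction a using FreeAlgebra.induction with
  | grade0 r => simpa using algebraMap r
  | grade1 x => exact gen x
  | mul a b ha hb => simpa using mul _ _ ha hb
  | add a b ha hb => simpa using add _ _ ha hb

theorem Z_commute (u : U) : Commute Z u := by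
  induction u using U_induction with
  | algebraMap r => exact (Algebra.commutes r Z).symm
  | gen g => exact Z_mul_gen g
  | mul a b ha hb => exact ha.mul_right hb
  | add a b ha hb => exact ha.add_right hb

/-- The Casimir element of `sl₂`. -/
def casimir : U := H * H + 2 * H + 4 * (F * E)

theorem E_mul_casimir : E * casimir = casimir * E := by
  have h1 : E * H = H * E - 2 * E := by rw [H_mul_E]; abel
  have h2 : E * (H * H) = H * H * E - 4 * (H * E) + 4 * E := by
    rw [← mul_assoc, h1, sub_mul, mul_assoc, h1, mul_assoc 2, h1]; noncomm_ring
  have h3 : E * (F * E) = F * E * E + H * E := by rw [← mul_assoc, E_mul_F, add_mul]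
  have : E * casimir = E * (H * H) + 2 * (E * H) + 4 * (E * (F * E)) := by
    unfold casimir; noncomm_ring
  rw [this, h1, h2, h3]; unfold casimir; noncomm_ring

theorem F_mul_casimir : F * casimir = casimir * F := by
  have h1 : H * F = F * H - 2 * F := H_mul_F
  have h2 : H * (H * F) = F * (H * H) - 4 * (F * H) + 4 * F := by
    rw [h1, mul_sub, ← mul_assoc, h1]
    have : H * (2 * F) = 2 * (H * F) := by noncomm_ring
    rw [this, h1]; noncomm_ring
  have h3 : F * E * F = F * (F * E) + F * H := by rw [mul_assoc, E_mul_F, mul_add]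
  have : casimir * F = H * (H * F) + 2 * (H * F) + 4 * (F * E * F) := by
    unfold casimir; noncomm_ring
  rw [this, h2, h1, h3]; unfold casimir; noncomm_ring

theorem H_mul_casimir : H * casimir = casimir * H := by
  have h : H * (F * E) = F * E * H := by
    rw [← mul_assoc, H_mul_F, sub_mul, mul_assoc F H E, H_mul_E]; noncomm_ring
  have : H * casimir = H * H * H + 2 * (H * H) + 4 * (H * (F * E)) := by
    unfold casimir; noncomm_ring
  rw [this, h]; unfold casimir; noncomm_ring

end Relations

theorem Q_smul_F_pow_smul {X : Type} [AddCommGroup X] [Module U X] (x : X) (k : ℕ) :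
    Q • F ^ k • x = F ^ k • Q • x := by
  have : Commute Q F := F_mul_Q.symm
  rw [smul_smul, (this.pow_right k).eq, mul_smul]

section Modules

variable {X : Type} [AddCommGroup X] [Module ℂ X] [Module U X] [IsScalarTower ℂ U X]

theorem sc_smul (c : ℂ) (x : X) : sc c • x = c • x := algebraMap_smul U c x

/-- A `ℂ`-subspace stable under the generators is stable under `U`. -/
theorem smul_mem_of_gen_smul_mem (W : Submodule ℂ X) (hW : ∀ g, ∀ x ∈ W, gen g • x ∈ W)
    (u : U) {x : X} (hx : x ∈ W) : u • x ∈ W := by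
  induction u using U_induction generalizing x with
  | algebraMap r => rw [algebraMap_smul]; exact W.smul_mem _ hx
  | gen g => exact hW g x hx
  | mul a b ha hb => rw [mul_smul]; exact ha (hb hx)
  | add a b ha hb => rw [add_smul]; exact W.add_mem (ha hx) (hb hx)

/-- A `ℂ`-linear map commuting with the generators is `U`-linear. -/
def mkULinear {Y : Type} [AddCommGroup Y] [Module ℂ Y] [Module U Y] [IsScalarTower ℂ U Y]
    (f : X →ₗ[ℂ] Y) (hf : ∀ g x, f (gen g • x) = gen g • f x) : X →ₗ[U] Y where
  toFun := f
  map_add' := map_add f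
  map_smul' u x := by
    simp only [RingHom.id_apply]
    induction u using U_induction generalizing x with
    | algebraMap r => simp only [algebraMap_smul, map_smul]
    | gen g => exact hf g x
    | mul a b ha hb => simp only [mul_smul, ha, hb]
    | add a b ha hb => simp only [add_smul, map_add, ha, hb]

theorem H_smul_E_smul {x : X} {μ : ℂ} (hx : H • x = μ • x) : H • E • x = (μ + 2) • E • x := by
  rw [smul_smul, H_mul_E, add_smul, mul_smul, hx, mul_smul, ofNat_smul_eq_nsmul U 2 (E • x),
    smul_comm]
  generalize E • x = y
  module

theorem H_smul_F_smul {x : X} {μ : ℂ} (hx : H • x = μ • x) : H • F • x = (μ - 2) • F • x := by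
  rw [smul_smul, H_mul_F, sub_smul, mul_smul, hx, mul_smul, ofNat_smul_eq_nsmul U 2 (F • x),
    smul_comm]
  generalize F • x = y
  module

theorem H_smul_P_smul {x : X} {μ : ℂ} (hx : H • x = μ • x) : H • P • x = (μ + 1) • P • x := by
  rw [smul_smul, H_mul_P, add_smul, mul_smul, hx, smul_comm]
  generalize P • x = y
  module

theorem H_smul_Q_smul {x : X} {μ : ℂ} (hx : H • x = μ • x) : H • Q • x = (μ - 1) • Q • x := by
  rw [smul_smul, H_mul_Q, sub_smul, mul_smul, hx, smul_comm]
  generalize Q • x = y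
  module

theorem H_smul_F_pow_smul {x : X} {μ : ℂ} (hx : H • x = μ • x) (k : ℕ) :
    H • F ^ k • x = (μ - 2 * k) • F ^ k • x := by
  induction k with
  | zero => simpa using hx
  | succ k ih =>
    rw [pow_succ', mul_smul, H_smul_F_smul ih]
    generalize F • F ^ k • x = y
    push_cast
    module

theorem E_smul_F_pow_succ_smul {x : X} {μ : ℂ} (hx : H • x = μ • x) (k : ℕ) :
    E • F ^ (k + 1) • x = F ^ (k + 1) • E • x + ((k + 1) * (μ - k)) • F ^ k • x := by
  induction k with
  | zero =>
    simp only [zero_add, pow_one, pow_zero, one_smul]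
    rw [smul_smul, E_mul_F, add_smul, mul_smul, hx]
    simp
  | succ k ih =>
    rw [pow_succ' F (k + 1), mul_smul, smul_smul, E_mul_F, add_smul, mul_smul, ih,
      H_smul_F_pow_smul hx, smul_add, ← mul_smul, smul_comm F, ← mul_smul F, ← pow_succ',
      ← pow_succ']
    generalize F ^ (k + 1) • x = y, F ^ (k + 1 + 1) • E • x = z
    push_cast
    module

theorem P_smul_F_pow_smul (x : X) (k : ℕ) :
    P • F ^ k • x = F ^ k • P • x - (k : ℂ) • F ^ (k - 1) • Q • x := by
  have hPF : P * F = F * P - Q := by rw [F_mul_P]; abel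
  induction k with
  | zero => simp
  | succ k ih =>
    rw [pow_succ', mul_smul, smul_smul, hPF, sub_smul, mul_smul, ih, Q_smul_F_pow_smul, smul_sub,
      mul_smul, smul_comm F (k : ℂ)]
    rcases k with _ | k
    · simp
    · simp only [Nat.add_sub_cancel, pow_succ' F k, mul_smul]
      generalize F • F ^ k • Q • x = y, F • F • F ^ k • P • x = z
      push_cast
      module

theorem aeval_H_smul {x : X} {μ : ℂ} (hx : H • x = μ • x) (p : Polynomial ℂ) :
    Polynomial.aeval H p • x = p.eval μ • x := by
  induction p using Polynomial.induction_on' with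
  | add p q hp hq => simp only [map_add, add_smul, hp, hq, Polynomial.eval_add]
  | monomial n a =>
    rw [Polynomial.aeval_monomial, Polynomial.eval_monomial, mul_smul, mul_smul, algebraMap_smul]
    congr 1
    induction n with
    | zero => simp
    | succ n ih => rw [pow_succ', mul_smul, ih, smul_comm, hx, smul_smul, pow_succ]

theorem cmod_eq : cmod X = ‹Module ℂ X› := by
  refine Module.ext' _ _ fun r x => ?_
  exact algebraMap_smul U r x

/-- A sufficient criterion for membership in category `O` in terms of a spanning set. -/
theorem inO_of_span (S : Set X) (hfin : Module.Finite U X) (hS : Submodule.span ℂ S = ⊤)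
    (hH : ∀ x ∈ S, ∃ μ : ℂ, H • x = μ • x) (hZ : ∀ x : X, Z • x = 0)
    (hn : ∀ x ∈ S, ∃ W : Submodule ℂ X, FiniteDimensional ℂ W ∧ x ∈ W ∧
      (∀ w ∈ W, E • w ∈ W) ∧ ∀ w ∈ W, P • w ∈ W) : InO X := by
  refine ⟨hfin, fun v => ?_, ?_⟩
  · have hv : v ∈ Submodule.span ℂ S := hS ▸ Submodule.mem_top
    induction hv using Submodule.span_induction with
    | mem x hx =>
      obtain ⟨μ, hμ⟩ := hH x hx
      exact AddSubgroup.subset_closure ⟨μ, 0, by rw [hμ, sc_smul], by rw [hZ, sc_smul, zero_smul]⟩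
    | zero => exact zero_mem _
    | add x y _ _ hx hy => exact add_mem hx hy
    | smul a x _ hx =>
      clear * - hx
      induction hx using AddSubgroup.closure_induction with
      | mem w hw =>
        obtain ⟨hh, zz, h1, h2⟩ := hw
        rw [sc_smul] at h1 h2
        exact AddSubgroup.subset_closure ⟨hh, zz, by rw [sc_smul, smul_comm, h1, smul_comm],
          by rw [sc_smul, smul_comm, h2, smul_comm]⟩
      | zero => rw [smul_zero]; exact zero_mem _
      | add x y _ _ hx hy => rw [smul_add]; exact add_mem hx hy
      | neg x _ hx => rw [smul_neg]; exact neg_mem hx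
  · rw [cmod_eq]
    have key : ∀ v : X, ∃ W : Submodule ℂ X, FiniteDimensional ℂ W ∧ v ∈ W ∧
        (∀ w ∈ W, E • w ∈ W) ∧ ∀ w ∈ W, P • w ∈ W := by
      intro v
      have hv : v ∈ Submodule.span ℂ S := hS ▸ Submodule.mem_top
      induction hv using Submodule.span_induction with
      | mem x hx => exact hn x hx
      | zero => exact ⟨⊥, inferInstance, zero_mem _, by simp, by simp⟩
      | add x y _ _ hx hy =>
        obtain ⟨W, _, hxW, hE, hP⟩ := hx
        obtain ⟨W', _, hyW, hE', hP'⟩ := hy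
        refine ⟨W ⊔ W', inferInstance, Submodule.add_mem_sup hxW hyW, fun w hw => ?_,
          fun w hw => ?_⟩ <;>
        · obtain ⟨a, ha, b, hb, rfl⟩ := Submodule.mem_sup.mp hw
          rw [smul_add]
          apply Submodule.add_mem_sup <;> solve_by_elim
      | smul a x _ hx =>
        obtain ⟨W, hf, hxW, hE, hP⟩ := hx
        exact ⟨W, hf, W.smul_mem _ hxW, hE, hP⟩
    intro v
    obtain ⟨W, hf, hvW, hE, hP⟩ := key v
    refine ⟨W, hf, fun u hu => ?_⟩
    have : ∀ w ∈ W, u • w ∈ W := by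
      induction hu using Algebra.adjoin_induction with
      | mem x hx =>
        rcases hx with rfl | rfl
        · exact hE
        · exact hP
      | algebraMap r => intro w hw; rw [algebraMap_smul]; exact W.smul_mem _ hw
      | add x y _ _ hx hy => intro w hw; rw [add_smul]; exact add_mem (hx w hw) (hy w hw)
      | mul x y _ _ hx hy => intro w hw; rw [mul_smul]; exact hx _ (hy w hw)
    exact this v hvW

end Modules

/-! ### Modules given by operators -/

section Representations

variable {V : Type} [AddCommGroup V] [Module ℂ V]

/-- The action of `U` on `V` given by operators satisfying the defining relations. -/
def repHom (ρ : Gen → Module.End ℂ V)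
    (h : ∀ ⦃a b⦄, Rel a b → FreeAlgebra.lift ℂ ρ a = FreeAlgebra.lift ℂ ρ b) :
    U →ₐ[ℂ] Module.End ℂ V :=
  RingQuot.liftAlgHom ℂ ⟨FreeAlgebra.lift ℂ ρ, h⟩

theorem repHom_gen (ρ : Gen → Module.End ℂ V)
    (h : ∀ ⦃a b⦄, Rel a b → FreeAlgebra.lift ℂ ρ a = FreeAlgebra.lift ℂ ρ b) (g : Gen) :
    repHom ρ h (gen g) = ρ g := by
  simp [repHom, gen, ιg]

end Representations

/-! ### The simple `sl₂`-modules -/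

/-- `k` indexes a basis vector of the simple highest weight module of highest weight `i`. -/
def IsIdx (i : ℤ) (k : ℕ) : Prop := i < 0 ∨ (k : ℤ) ≤ i

/-- A concrete model of the simple highest weight `U`-module with highest weight `i`
and zero central charge. -/
def LM (i : ℤ) : Type := {k : ℕ // IsIdx i k} →₀ ℂ

namespace LM

variable {i j : ℤ}

instance : AddCommGroup (LM i) := inferInstanceAs (AddCommGroup ({k : ℕ // IsIdx i k} →₀ ℂ))

instance : Module ℂ (LM i) := inferInstanceAs (Module ℂ ({k : ℕ // IsIdx i k} →₀ ℂ))

open Classical in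
/-- The vector `f ^ k v` for the highest weight vector `v`. -/
def bv (i : ℤ) (k : ℕ) : LM i :=
  if h : IsIdx i k then
    show LM i from (Finsupp.single (⟨k, h⟩ : {k : ℕ // IsIdx i k}) (1 : ℂ))
  else 0

theorem bv_of_isIdx {k : ℕ} (h : IsIdx i k) :
    bv i k = (Finsupp.single (⟨k, h⟩ : {k : ℕ // IsIdx i k}) (1 : ℂ)) := dif_pos h

theorem bv_eq_zero {k : ℕ} (h : ¬ IsIdx i k) : bv i k = 0 := by simp [bv, h]

/-- The linear map with prescribed values on the basis vectors. -/
def lin {W : Type} [AddCommGroup W] [Module ℂ W] (w : ℕ → W) : LM i →ₗ[ℂ] W :=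
  Finsupp.linearCombination ℂ fun k : {k : ℕ // IsIdx i k} => w k

section
variable {W : Type} [AddCommGroup W] [Module ℂ W]

theorem lin_bv {w : ℕ → W} {k : ℕ} (h : IsIdx i k) : lin w (bv i k) = w k := by
  rw [bv_of_isIdx h]
  exact (Finsupp.linearCombination_single ℂ (1 : ℂ) (⟨k, h⟩ : {k : ℕ // IsIdx i k})).trans
    (one_smul ℂ (w k))

theorem lin_bv_of_forall {w : ℕ → W} (hw : ∀ k, ¬ IsIdx i k → w k = 0) (k : ℕ) :
    lin w (bv i k) = w k := by
  by_cases h : IsIdx i k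
  · exact lin_bv h
  · rw [bv_eq_zero h, map_zero, hw k h]

theorem hom_ext {f g : LM i →ₗ[ℂ] W} (h : ∀ k, IsIdx i k → f (bv i k) = g (bv i k)) : f = g := by
  refine Finsupp.lhom_ext' fun k => LinearMap.ext_ring ?_
  have := h k k.2
  rw [bv_of_isIdx k.2] at this
  exact this

end

theorem span_bv : Submodule.span ℂ (Set.range (bv i)) = ⊤ := by
  rw [← LinearMap.ker_eq_top.mpr (show (Submodule.span ℂ (Set.range (bv i))).mkQ = 0 from
    hom_ext fun k _ => ?_), Submodule.ker_mkQ]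
  rw [LinearMap.zero_apply, Submodule.mkQ_apply, Submodule.Quotient.mk_eq_zero]
  exact Submodule.subset_span ⟨k, rfl⟩

/-- The coefficient of a basis vector. -/
def coeff (k : ℕ) : LM i →ₗ[ℂ] ℂ := lin fun l => if l = k then 1 else 0

theorem coeff_bv {k l : ℕ} (h : IsIdx i l) : coeff k (bv i l) = if l = k then 1 else 0 := lin_bv h

theorem coeff_bv_self {k : ℕ} (h : IsIdx i k) : coeff k (bv i k) = 1 := by simp [coeff_bv h]

theorem ext_coeff {m m' : LM i} (h : ∀ k, IsIdx i k → coeff k m = coeff k m') : m = m' := by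
  have key : ∀ (k : {k : ℕ // IsIdx i k}) (m : LM i),
      coeff (k : ℕ) m = (show {k : ℕ // IsIdx i k} →₀ ℂ from m) k := by
    intro k m
    refine LinearMap.congr_fun (f := coeff (k : ℕ)) (g := Finsupp.lapply k) (hom_ext ?_) m
    intro l hl
    rw [coeff_bv hl, bv_of_isIdx hl]
    refine Eq.trans ?_ (Finsupp.single_apply (a := ⟨l, hl⟩) (a' := k) (b := (1 : ℂ))).symm
    simp [Subtype.ext_iff]
  refine Finsupp.ext fun k => ?_
  rw [← key, ← key]
  exact h k k.2

theorem bv_ne_zero {k : ℕ} (h : IsIdx i k) : bv i k ≠ 0 := fun h0 => by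
  have := coeff_bv_self h
  simp [h0] at this

/-- The operators by which the generators act on `LM i`. -/
def op (i : ℤ) : Gen → Module.End ℂ (LM i)
  | .E => lin fun k => ((k : ℂ) * (i - k + 1)) • bv i (k - 1)
  | .H => lin fun k => ((i : ℂ) - 2 * k) • bv i k
  | .F => lin fun k => bv i (k + 1)
  | _ => 0

theorem op_E_bv (k : ℕ) : op i .E (bv i k) = ((k : ℂ) * (i - k + 1)) • bv i (k - 1) := by
  refine lin_bv_of_forall (w := fun k => ((k : ℂ) * (i - k + 1)) • bv i (k - 1))
    (fun k hk => ?_) k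
  by_cases h : IsIdx i (k - 1)
  · have : (k : ℤ) = i + 1 := by unfold IsIdx at *; omega
    have : (k : ℂ) = i + 1 := by exact_mod_cast this
    simp [this]
  · rw [bv_eq_zero h, smul_zero]

theorem op_F_bv (k : ℕ) : op i .F (bv i k) = bv i (k + 1) := by
  refine lin_bv_of_forall (w := fun k => bv i (k + 1)) (fun k hk => bv_eq_zero ?_) k
  unfold IsIdx at *; omega

theorem op_H_bv (k : ℕ) : op i .H (bv i k) = ((i : ℂ) - 2 * k) • bv i k :=
  lin_bv_of_forall (w := fun k => ((i : ℂ) - 2 * k) • bv i k)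
    (fun k hk => by rw [bv_eq_zero hk, smul_zero]) k

theorem op_P : op i .P = 0 := rfl
theorem op_Q : op i .Q = 0 := rfl
theorem op_Z : op i .Z = 0 := rfl

theorem op_H_mul_op_E : op i .H * op i .E = op i .E * op i .H + 2 * op i .E := by
  refine hom_ext fun k _ => ?_
  rcases k with _ | k
  · simp [op_E_bv, op_H_bv]
  · simp only [Module.End.mul_apply, LinearMap.add_apply, Module.End.ofNat_apply, op_E_bv, op_H_bv,
      map_smul]
    push_cast
    module

theorem op_E_mul_op_F : op i .E * op i .F = op i .F * op i .E + op i .H := by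
  refine hom_ext fun k _ => ?_
  rcases k with _ | k
  · simp [op_E_bv, op_H_bv, op_F_bv]
  · simp only [Module.End.mul_apply, LinearMap.add_apply, op_E_bv, op_H_bv, op_F_bv, map_smul]
    push_cast
    module

theorem op_H_mul_op_F : op i .H * op i .F = op i .F * op i .H - 2 * op i .F := by
  refine hom_ext fun k _ => ?_
  simp only [Module.End.mul_apply, LinearMap.sub_apply, Module.End.ofNat_apply, op_F_bv, op_H_bv,
      map_smul]
  push_cast
  module

theorem op_rel ⦃a b : FA⦄ (h : Rel a b) :
    FreeAlgebra.lift ℂ (op i) a = FreeAlgebra.lift ℂ (op i) b := by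
  have h2 : FreeAlgebra.lift ℂ (op i) 2 = 2 := map_ofNat _ 2
  cases h <;> simp [ιg, h2, op_H_mul_op_E, op_E_mul_op_F, op_H_mul_op_F, op_P, op_Q, op_Z]

instance : Module U (LM i) := Module.compHom _ (repHom (op i) op_rel).toRingHom

theorem smul_def (u : U) (m : LM i) : u • m = repHom (op i) op_rel u m := rfl

theorem gen_smul (g : Gen) (m : LM i) : gen g • m = op i g m := by
  rw [smul_def, repHom_gen]

instance : IsScalarTower ℂ U (LM i) := ⟨fun c u m => by simp [smul_def]⟩

theorem E_smul_bv (k : ℕ) : E • bv i k = ((k : ℂ) * (i - k + 1)) • bv i (k - 1) :=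
  (gen_smul _ _).trans (op_E_bv k)

theorem F_smul_bv (k : ℕ) : F • bv i k = bv i (k + 1) := (gen_smul _ _).trans (op_F_bv k)

theorem H_smul_bv (k : ℕ) : H • bv i k = ((i : ℂ) - 2 * k) • bv i k :=
  (gen_smul _ _).trans (op_H_bv k)

theorem P_smul (m : LM i) : P • m = 0 := gen_smul _ _
theorem Q_smul (m : LM i) : Q • m = 0 := gen_smul _ _
theorem Z_smul (m : LM i) : Z • m = 0 := gen_smul _ _

theorem F_pow_smul_bv (k l : ℕ) : F ^ k • bv i l = bv i (k + l) := by
  induction k with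
  | zero => simp
  | succ k ih => rw [pow_succ', mul_smul, ih, F_smul_bv, add_right_comm]

theorem isIdx_zero (i : ℤ) : IsIdx i 0 := by unfold IsIdx; omega

theorem coeff_H_smul (k : ℕ) (m : LM i) : coeff k (H • m) = ((i : ℂ) - 2 * k) * coeff k m := by
  have : (coeff k ∘ₗ op i .H : LM i →ₗ[ℂ] ℂ) = ((i : ℂ) - 2 * k) • coeff k := hom_ext fun l hl => by
    rw [LinearMap.comp_apply, op_H_bv, map_smul, LinearMap.smul_apply, coeff_bv hl]
    split_ifs with h <;> simp [h]
  rw [show H • m = op i .H m from gen_smul _ _]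
  exact LinearMap.congr_fun this m

theorem coeff_E_smul {k : ℕ} (m : LM i) :
    coeff k (E • m) = ((k + 1 : ℂ) * (i - k)) * coeff (k + 1) m := by
  have : (coeff k ∘ₗ op i .E : LM i →ₗ[ℂ] ℂ) = ((k + 1 : ℂ) * (i - k)) • coeff (k + 1) :=
    hom_ext fun l hl => by
      have hl' : IsIdx i (l - 1) := by unfold IsIdx at *; omega
      rw [LinearMap.comp_apply, op_E_bv, map_smul, LinearMap.smul_apply, coeff_bv hl, coeff_bv hl']
      rcases l with _ | l
      · simp
      · simp only [Nat.add_sub_cancel, Nat.add_right_cancel_iff]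
        split_ifs with h
        · subst h; push_cast; simp only [smul_eq_mul]; ring
        · simp
  rw [show E • m = op i .E m from gen_smul _ _]
  exact LinearMap.congr_fun this m

theorem eq_zero_of_H_smul {m : LM i} {μ : ℂ} (hm : H • m = μ • m)
    (hμ : ∀ k, IsIdx i k → μ ≠ i - 2 * k) : m = 0 := by
  refine ext_coeff fun k hk => ?_
  have := congrArg (coeff k) hm
  rw [coeff_H_smul, map_smul, smul_eq_mul] at this
  rw [map_zero]
  by_contra h
  exact hμ k hk (mul_right_cancel₀ h this).symm

theorem eq_coeff_smul_bv {m : LM i} {k : ℕ} (hm : H • m = ((i : ℂ) - 2 * k) • m) :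
    m = coeff k m • bv i k := by
  refine ext_coeff fun l hl => ?_
  rw [map_smul]
  by_cases hlk : l = k
  · subst hlk; simp [coeff_bv_self hl]
  · have := congrArg (coeff l) hm
    rw [coeff_H_smul, map_smul, smul_eq_mul] at this
    have h0 : coeff l m = 0 := by
      by_contra h
      have h1 := mul_right_cancel₀ h this
      apply hlk
      have : (l : ℂ) = k := by linear_combination -h1 / 2
      exact_mod_cast this
    by_cases hk : IsIdx i k
    · simp [h0, coeff_bv hk, Ne.symm hlk]
    · simp [h0, bv_eq_zero hk]

theorem eq_smul_bv_zero_of_E_smul {m : LM i} (hm : E • m = 0) : m = coeff 0 m • bv i 0 := by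
  refine ext_coeff fun l hl => ?_
  rw [map_smul, coeff_bv (isIdx_zero i)]
  rcases l with _ | l
  · simp
  · have := congrArg (coeff l) hm
    rw [coeff_E_smul, map_zero] at this
    have h1 : (l + 1 : ℂ) ≠ 0 := by exact_mod_cast Nat.succ_ne_zero l
    have h2 : (i - l : ℂ) ≠ 0 := by
      have : i - l ≠ 0 := by unfold IsIdx at hl; omega
      exact_mod_cast this
    have : coeff (l + 1) m = 0 := by simpa [h1, h2] using this
    simp [this]

theorem E_pow_smul_eq_zero (m : LM i) : ∃ n, E ^ n • m = 0 := by
  have hm : m ∈ Submodule.span ℂ (Set.range (bv i)) := span_bv ▸ Submodule.mem_top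
  have hmono : ∀ {n n' : ℕ} {m : LM i}, n ≤ n' → E ^ n • m = 0 → E ^ n' • m = 0 := by
    intro n n' m h h0
    rw [← Nat.sub_add_cancel h, pow_add, mul_smul, h0, smul_zero]
  induction hm using Submodule.span_induction with
  | mem x hx =>
    obtain ⟨k, rfl⟩ := hx
    refine ⟨k + 1, ?_⟩
    induction k with
    | zero => simp [E_smul_bv]
    | succ k ih => rw [pow_succ, mul_smul, E_smul_bv, smul_comm, Nat.add_sub_cancel, ih, smul_zero]
  | zero => exact ⟨0, smul_zero _⟩
  | add x y _ _ hx hy =>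
    obtain ⟨n, hn⟩ := hx
    obtain ⟨n', hn'⟩ := hy
    exact ⟨max n n', by rw [smul_add, hmono (le_max_left _ _) hn, hmono (le_max_right _ _) hn',
      add_zero]⟩
  | smul a x _ hx =>
    obtain ⟨n, hn⟩ := hx
    exact ⟨n, by rw [smul_comm, hn, smul_zero]⟩

theorem exists_smul_eq_bv_zero {m : LM i} (hm : m ≠ 0) : ∃ u : U, u • m = bv i 0 := by
  classical
  have hex := E_pow_smul_eq_zero m
  set n := Nat.find hex with hn
  have h0 : E ^ n • m = 0 := Nat.find_spec hex
  rcases hn' : n with _ | n'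
  · rw [hn'] at h0; simp [hm] at h0
  · have h1 : E ^ n' • m ≠ 0 := Nat.find_min hex (m := n') (by omega)
    rw [hn', pow_succ', mul_smul] at h0
    have h2 := eq_smul_bv_zero_of_E_smul h0
    set c := coeff 0 (E ^ n' • m)
    have hc : c ≠ 0 := fun hc => h1 (by rw [h2, hc, zero_smul])
    exact ⟨sc c⁻¹ * E ^ n', by rw [mul_smul, h2, sc_smul, inv_smul_smul₀ hc]⟩

theorem span_bv_zero : Submodule.span U {bv i 0} = ⊤ := by
  rw [eq_top_iff]
  intro m _
  have hm : m ∈ Submodule.span ℂ (Set.range (bv i)) := span_bv ▸ Submodule.mem_top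
  refine Submodule.span_induction (p := fun m _ => m ∈ Submodule.span U {bv i 0}) ?_
    (zero_mem _) (fun _ _ _ _ => add_mem) (fun a x _ hx => ?_) hm
  · rintro _ ⟨k, rfl⟩
    have := F_pow_smul_bv (i := i) k 0
    rw [add_zero] at this
    rw [← this]
    exact Submodule.smul_mem _ _ (Submodule.mem_span_singleton_self _)
  · rw [← sc_smul]
    exact Submodule.smul_mem _ _ hx

instance : Module.Finite U (LM i) := ⟨⟨{bv i 0}, by simpa using span_bv_zero⟩⟩

theorem casimir_smul (m : LM i) : casimir • m = ((i : ℂ) * (i + 2)) • m := by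
  have key : repHom (op i) op_rel casimir = ((i : ℂ) * (i + 2)) • LinearMap.id :=
    hom_ext fun k _ => by
      have hFE : F • E • bv i k = ((k : ℂ) * (i - k + 1)) • bv i k := by
        rw [E_smul_bv, smul_comm, F_smul_bv]
        rcases k with _ | k
        · simp
        · rfl
      rw [← smul_def, casimir]
      simp only [add_smul, mul_smul (2 : U), mul_smul H, mul_smul (4 : U), mul_smul F, hFE,
        H_smul_bv, LinearMap.smul_apply, LinearMap.id_apply, ofNat_smul_eq_nsmul U 2,
        ofNat_smul_eq_nsmul U 4, smul_comm H ((i : ℂ) - 2 * k)]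
      module
  exact LinearMap.congr_fun key m

end LM

/-! ### Identification of the simple quotient of the Verma module -/

section Verma

variable {i : ℤ}

theorem smul_hwVec_eq_zero {hh zz : ℂ} {u : U} (hu : u ∈ vermaIdeal hh zz) :
    u • hwVec hh zz = 0 := by
  rw [hwVec, ← Submodule.Quotient.mk_smul, Submodule.Quotient.mk_eq_zero, smul_eq_mul, mul_one]
  exact hu

theorem span_hwVec (hh zz : ℂ) : Submodule.span U {hwVec hh zz} = ⊤ := by
  rw [eq_top_iff]
  intro x _
  obtain ⟨u, rfl⟩ := Submodule.Quotient.mk_surjective _ x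
  refine Submodule.mem_span_singleton.mpr ⟨u, ?_⟩
  rw [hwVec, ← Submodule.Quotient.mk_smul, smul_eq_mul, mul_one]

theorem E_smul_hwVec (hh zz : ℂ) : E • hwVec hh zz = 0 :=
  smul_hwVec_eq_zero (Submodule.subset_span (by simp))

theorem P_smul_hwVec (hh zz : ℂ) : P • hwVec hh zz = 0 :=
  smul_hwVec_eq_zero (Submodule.subset_span (by simp))

theorem H_smul_hwVec (hh zz : ℂ) : H • hwVec hh zz = hh • hwVec hh zz := by
  rw [← sc_smul, ← sub_eq_zero, ← sub_smul]
  exact smul_hwVec_eq_zero (Submodule.subset_span (by simp))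

theorem Z_smul_hwVec (hh zz : ℂ) : Z • hwVec hh zz = zz • hwVec hh zz := by
  rw [← sc_smul, ← sub_eq_zero, ← sub_smul]
  exact smul_hwVec_eq_zero (Submodule.subset_span (by simp))

theorem Z_smul_eq_zero (hh : ℂ) (x : Verma hh 0) : Z • x = 0 := by
  have hx : x ∈ Submodule.span U {hwVec hh 0} := span_hwVec hh 0 ▸ Submodule.mem_top
  obtain ⟨u, rfl⟩ := Submodule.mem_span_singleton.mp hx
  rw [smul_smul, (Z_commute u).eq, mul_smul, Z_smul_hwVec, zero_smul, smul_zero]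

theorem H_smul_Q_pow_smul_hwVec (hh : ℂ) (b : ℕ) :
    H • Q ^ b • hwVec hh 0 = (hh - b) • Q ^ b • hwVec hh 0 := by
  induction b with
  | zero => simpa using H_smul_hwVec hh 0
  | succ b ih =>
    rw [pow_succ', mul_smul, H_smul_Q_smul ih]
    push_cast
    rw [sub_sub]

theorem P_smul_Q_pow_smul_hwVec (hh : ℂ) (b : ℕ) : P • Q ^ b • hwVec hh 0 = 0 := by
  induction b with
  | zero => simpa using P_smul_hwVec hh 0
  | succ b ih =>
    rw [pow_succ', mul_smul, smul_smul, P_mul_Q, add_smul, mul_smul, ih, Z_smul_eq_zero, smul_zero,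
      add_zero]

theorem E_smul_Q_pow_smul_hwVec (hh : ℂ) (b : ℕ) : E • Q ^ b • hwVec hh 0 = 0 := by
  induction b with
  | zero => simpa using E_smul_hwVec hh 0
  | succ b ih =>
    rw [pow_succ', mul_smul, smul_smul, E_mul_Q, add_smul, mul_smul, ih, P_smul_Q_pow_smul_hwVec,
      smul_zero, add_zero]

/-- The vectors `f ^ a q ^ b v` span the Verma module of zero central charge. -/
theorem span_F_pow_Q_pow (hh : ℂ) :
    Submodule.span ℂ (Set.range fun n : ℕ × ℕ => F ^ n.1 • Q ^ n.2 • hwVec hh 0) = ⊤ := by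
  set W := Submodule.span ℂ (Set.range fun n : ℕ × ℕ => F ^ n.1 • Q ^ n.2 • hwVec hh 0)
  have hmem : ∀ a b, F ^ a • Q ^ b • hwVec hh 0 ∈ W := fun a b =>
    Submodule.subset_span ⟨(a, b), rfl⟩
  have hW : ∀ g, ∀ x ∈ W, gen g • x ∈ W := by
    intro g x hx
    induction hx using Submodule.span_induction with
    | mem x hx =>
      obtain ⟨⟨a, b⟩, rfl⟩ := hx
      have hQ := H_smul_Q_pow_smul_hwVec hh b
      cases g with
      | E =>
        change E • F ^ a • Q ^ b • hwVec hh 0 ∈ W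
        rcases a with _ | a
        · rw [pow_zero, one_smul, E_smul_Q_pow_smul_hwVec]
          exact zero_mem _
        · rw [E_smul_F_pow_succ_smul hQ, E_smul_Q_pow_smul_hwVec, smul_zero, zero_add]
          exact W.smul_mem _ (hmem _ _)
      | H =>
        change H • F ^ a • Q ^ b • hwVec hh 0 ∈ W
        rw [H_smul_F_pow_smul hQ]
        exact W.smul_mem _ (hmem _ _)
      | F =>
        change F • F ^ a • Q ^ b • hwVec hh 0 ∈ W
        rw [← mul_smul, ← pow_succ']
        exact hmem _ _
      | P =>
        change P • F ^ a • Q ^ b • hwVec hh 0 ∈ W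
        rw [P_smul_F_pow_smul, P_smul_Q_pow_smul_hwVec, smul_zero, ← mul_smul Q, ← pow_succ']
        exact W.sub_mem (zero_mem _) (W.smul_mem _ (hmem _ _))
      | Q =>
        change Q • F ^ a • Q ^ b • hwVec hh 0 ∈ W
        rw [Q_smul_F_pow_smul, ← mul_smul Q, ← pow_succ']
        exact hmem _ _
      | Z =>
        change Z • F ^ a • Q ^ b • hwVec hh 0 ∈ W
        rw [Z_smul_eq_zero]
        exact zero_mem _
    | zero => rw [smul_zero]; exact zero_mem _
    | add x y _ _ hx hy => rw [smul_add]; exact add_mem hx hy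
    | smul a x _ hx => rw [smul_comm]; exact W.smul_mem _ hx
  rw [eq_top_iff]
  intro x _
  have hx : x ∈ Submodule.span U {hwVec hh 0} := span_hwVec hh 0 ▸ Submodule.mem_top
  obtain ⟨u, rfl⟩ := Submodule.mem_span_singleton.mp hx
  exact smul_mem_of_gen_smul_mem W hW u (by simpa using hmem 0 0)

/-- Every vector of the Verma module is, up to a multiple of the highest weight vector,
annihilated by a polynomial in `h` not vanishing at the highest weight. -/
theorem exists_aeval_H_smul (hh : ℂ) (x : Verma hh 0) : ∃ (c : ℂ) (p : Polynomial ℂ),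
    p.eval hh ≠ 0 ∧ Polynomial.aeval H p • (x - c • hwVec hh 0) = 0 := by
  have hx : x ∈ Submodule.span ℂ (Set.range fun n : ℕ × ℕ => F ^ n.1 • Q ^ n.2 • hwVec hh 0) :=
    span_F_pow_Q_pow hh ▸ Submodule.mem_top
  induction hx using Submodule.span_induction with
  | mem x hx =>
    obtain ⟨⟨a, b⟩, rfl⟩ := hx
    by_cases h : 2 * a + b = 0
    · obtain ⟨rfl, rfl⟩ : a = 0 ∧ b = 0 := by omega
      exact ⟨1, 1, by simp, by simp⟩
    · refine ⟨0, Polynomial.X - Polynomial.C (hh - b - 2 * a), ?_, ?_⟩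
      · have : ((2 * a + b : ℕ) : ℂ) ≠ 0 := by exact_mod_cast h
        push_cast at this
        simp only [Polynomial.eval_sub, Polynomial.eval_X, Polynomial.eval_C]
        contrapose! this
        linear_combination this
      · rw [zero_smul, sub_zero]
        rw [aeval_H_smul (H_smul_F_pow_smul (H_smul_Q_pow_smul_hwVec hh b) a)]
        simp
  | zero => exact ⟨0, 1, by simp, by simp⟩
  | add x y _ _ hx hy =>
    obtain ⟨c, p, hp, hpx⟩ := hx
    obtain ⟨d, q, hq, hqy⟩ := hy
    refine ⟨c + d, p * q, by simp [hp, hq], ?_⟩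
    rw [show x + y - (c + d) • hwVec hh 0 = (x - c • hwVec hh 0) + (y - d • hwVec hh 0) by module,
      smul_add]
    nth_rewrite 1 [mul_comm p q]
    rw [map_mul, map_mul, mul_smul, mul_smul, hpx, hqy, smul_zero, smul_zero, add_zero]
  | smul a x _ hx =>
    obtain ⟨c, p, hp, hpx⟩ := hx
    refine ⟨a * c, p, hp, ?_⟩
    rw [mul_smul, ← smul_sub, smul_comm, hpx, smul_zero]

theorem vermaIdeal_le_ker (i : ℤ) :
    vermaIdeal i 0 ≤ LinearMap.ker (LinearMap.toSpanSingleton U (LM i) (LM.bv i 0)) := by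
  refine Submodule.span_le.mpr ?_
  rintro x (rfl | rfl | rfl | rfl) <;>
    simp [sub_smul, LM.E_smul_bv, LM.P_smul, LM.H_smul_bv, LM.Z_smul, sc_smul]

/-- The projection from the Verma module to the concrete simple module. -/
def vermaToLM (i : ℤ) : Verma i 0 →ₗ[U] LM i := (vermaIdeal i 0).liftQ _ (vermaIdeal_le_ker i)

theorem vermaToLM_hwVec (i : ℤ) : vermaToLM i (hwVec i 0) = LM.bv i 0 := by
  simp [vermaToLM, hwVec]

theorem vermaToLM_surjective (i : ℤ) : Function.Surjective (vermaToLM i) := by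
  rw [← LinearMap.range_eq_top, eq_top_iff, ← LM.span_bv_zero, Submodule.span_singleton_le_iff_mem]
  exact ⟨_, vermaToLM_hwVec i⟩

theorem vermaRad_eq_ker (i : ℤ) : vermaRad i 0 = LinearMap.ker (vermaToLM i) := by
  apply le_antisymm
  · refine sSup_le fun N hN n hn => ?_
    by_contra hn'
    obtain ⟨u, hu⟩ := LM.exists_smul_eq_bv_zero (m := vermaToLM i n) hn'
    obtain ⟨c, p, hp, hpx⟩ := exists_aeval_H_smul (i : ℂ) (u • n)
    rw [smul_sub, smul_comm _ c, aeval_H_smul (H_smul_hwVec _ _), sub_eq_zero] at hpx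
    have hc : c ≠ 0 := by
      rintro rfl
      have := congrArg (vermaToLM i) hpx
      rw [map_smul, map_smul, hu, aeval_H_smul (LM.H_smul_bv 0), zero_smul, map_zero] at this
      simp only [Nat.cast_zero, mul_zero, sub_zero] at this
      exact (smul_ne_zero hp (LM.bv_ne_zero (LM.isIdx_zero i))) this
    have hv : hwVec i 0 ∈ N := by
      have h1 : (c • Polynomial.eval (i : ℂ) p • hwVec (i : ℂ) 0) ∈ N := by
        rw [← hpx]
        exact N.smul_mem _ (N.smul_mem _ hn)
      rw [smul_smul] at h1
      have h2 := N.smul_mem (sc (c * Polynomial.eval (i : ℂ) p)⁻¹) h1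
      rwa [sc_smul, inv_smul_smul₀ (mul_ne_zero hc hp)] at h2
    refine hN (eq_top_iff.mpr ?_)
    rw [← span_hwVec, Submodule.span_singleton_le_iff_mem]
    exact hv
  · refine le_sSup fun h => ?_
    have : hwVec (i : ℂ) 0 ∈ LinearMap.ker (vermaToLM i) := h ▸ Submodule.mem_top
    rw [LinearMap.mem_ker, vermaToLM_hwVec] at this
    exact LM.bv_ne_zero (LM.isIdx_zero i) this

/-- The simple highest weight module of zero central charge is the concrete one. -/
def simpleHWEquiv (i : ℤ) : SimpleHW i 0 ≃ₗ[U] LM i :=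
  (Submodule.quotEquivOfEq _ _ (vermaRad_eq_ker i)).trans
    ((vermaToLM i).quotKerEquivOfSurjective (vermaToLM_surjective i))

end Verma

/-! ### Extensions described by cocycles -/

/-- Off-diagonal parts of the operators of an extension of `LM i` by `LM j`. -/
structure Cocycle (i j : ℤ) where
  e : LM i →ₗ[ℂ] LM j
  f : LM i →ₗ[ℂ] LM j
  p : LM i →ₗ[ℂ] LM j
  q : LM i →ₗ[ℂ] LM j
  he : LM.op j .H ∘ₗ e = e ∘ₗ LM.op i .H + 2 • e
  ef : LM.op j .E ∘ₗ f + e ∘ₗ LM.op i .F = LM.op j .F ∘ₗ e + f ∘ₗ LM.op i .E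
  hf : LM.op j .H ∘ₗ f = f ∘ₗ LM.op i .H - 2 • f
  eq : LM.op j .E ∘ₗ q = q ∘ₗ LM.op i .E + p
  ep : LM.op j .E ∘ₗ p = p ∘ₗ LM.op i .E
  hp : LM.op j .H ∘ₗ p = p ∘ₗ LM.op i .H + p
  fp : LM.op j .F ∘ₗ p = p ∘ₗ LM.op i .F + q
  fq : LM.op j .F ∘ₗ q = q ∘ₗ LM.op i .F
  hq : LM.op j .H ∘ₗ q = q ∘ₗ LM.op i .H - q
  bound : ∃ N : ℕ, ∀ k, e (LM.bv i k) ∈ Submodule.span ℂ (LM.bv j '' Set.Iic (k + N)) ∧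
    p (LM.bv i k) ∈ Submodule.span ℂ (LM.bv j '' Set.Iic (k + N))

namespace Cocycle

variable {i j : ℤ} (φ : Cocycle i j)

/-- The off-diagonal part of the action of a generator. -/
def map : Gen → (LM i →ₗ[ℂ] LM j)
  | .E => φ.e
  | .H => 0
  | .F => φ.f
  | .P => φ.p
  | .Q => φ.q
  | .Z => 0

/-- The action of a generator on the extension attached to a cocycle. -/
def op (g : Gen) : Module.End ℂ (LM i × LM j) :=
  LinearMap.prod (LM.op i g ∘ₗ LinearMap.fst ℂ _ _)
    (LM.op j g ∘ₗ LinearMap.snd ℂ _ _ + φ.map g ∘ₗ LinearMap.fst ℂ _ _)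

theorem op_apply (g : Gen) (x : LM i × LM j) :
    φ.op g x = (LM.op i g x.1, LM.op j g x.2 + φ.map g x.1) := rfl

theorem op_rel ⦃a b : FA⦄ (h : Rel a b) :
    FreeAlgebra.lift ℂ φ.op a = FreeAlgebra.lift ℂ φ.op b := by
  have h2 : FreeAlgebra.lift ℂ φ.op 2 = 2 := map_ofNat _ 2
  have hA := fun m => LinearMap.congr_fun (LM.op_rel (i := i) h) m
  have hB := fun m => LinearMap.congr_fun (LM.op_rel (i := j) h) m
  have h2A : FreeAlgebra.lift ℂ (LM.op i) 2 = 2 := map_ofNat _ 2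
  have h2B : FreeAlgebra.lift ℂ (LM.op j) 2 = 2 := map_ofNat _ 2
  have he := fun m => LinearMap.congr_fun φ.he m
  have hef := fun m => LinearMap.congr_fun φ.ef m
  have hhf := fun m => LinearMap.congr_fun φ.hf m
  have heq := fun m => LinearMap.congr_fun φ.eq m
  have hep := fun m => LinearMap.congr_fun φ.ep m
  have hhp := fun m => LinearMap.congr_fun φ.hp m
  have hfp := fun m => LinearMap.congr_fun φ.fp m
  have hfq := fun m => LinearMap.congr_fun φ.fq m
  have hhq := fun m => LinearMap.congr_fun φ.hq m
  refine LinearMap.ext fun x => ?_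
  cases h <;>
  · simp only [ιg, map_mul, map_add, map_sub, FreeAlgebra.lift_ι_apply, Module.End.mul_apply,
      LinearMap.add_apply, LinearMap.sub_apply, LinearMap.comp_apply, h2A, h2B, h2,
      Module.End.ofNat_apply, LinearMap.smul_apply] at *
    simp only [op_apply, map, LM.op_P, LM.op_Q, LM.op_Z, LinearMap.zero_apply, map_zero, map_add,
      add_zero, zero_add] at *
    try
      refine Prod.ext ?_ ?_
      · first | exact hA _ | simp
      · dsimp only [Prod.snd_add, Prod.snd_sub, Prod.smul_snd]
        grind

end Cocycle

/-- The extension of `LM i` by `LM j` attached to a cocycle. -/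
def ExtM {i j : ℤ} (_ : Cocycle i j) : Type := LM i × LM j

namespace ExtM

variable {i j : ℤ} {φ : Cocycle i j}

instance : AddCommGroup (ExtM φ) := inferInstanceAs (AddCommGroup (LM i × LM j))

instance : Module ℂ (ExtM φ) := inferInstanceAs (Module ℂ (LM i × LM j))

instance : Module U (ExtM φ) := 
  Module.compHom (ExtM φ)
    (show U →+* Module.End ℂ (ExtM φ) from (repHom φ.op φ.op_rel).toRingHom)

theorem gen_smul (g : Gen) (x : ExtM φ) :
    gen g • x = (show ExtM φ from (gen g • x.1, gen g • x.2 + φ.map g x.1)) := by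
  change repHom φ.op φ.op_rel (gen g) x = _
  rw [repHom_gen, LM.gen_smul, LM.gen_smul]
  rfl

instance : IsScalarTower ℂ U (ExtM φ) := ⟨fun c u m => by
  change repHom φ.op φ.op_rel (c • u) m = c • repHom φ.op φ.op_rel u m
  rw [map_smul]
  rfl⟩

/-- The inclusion of the submodule. -/
def incl (φ : Cocycle i j) : LM j →ₗ[U] ExtM φ :=
  mkULinear (show LM j →ₗ[ℂ] ExtM φ from LinearMap.inr ℂ (LM i) (LM j)) fun g b => by
    rw [gen_smul]
    change ((0 : LM i), gen g • b) = (gen g • (0 : LM i), gen g • b + φ.map g 0)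
    simp

/-- The projection to the quotient. -/
def proj (φ : Cocycle i j) : ExtM φ →ₗ[U] LM i :=
  mkULinear (show ExtM φ →ₗ[ℂ] LM i from LinearMap.fst ℂ (LM i) (LM j)) fun g b => by
    rw [gen_smul]
    rfl

end ExtM

namespace LM

variable {i j : ℤ}

/-- The span of the basis vectors with index at most `n`. -/
def trunc (i : ℤ) (n : ℕ) : Submodule ℂ (LM i) := Submodule.span ℂ (bv i '' Set.Iic n)

instance (n : ℕ) : FiniteDimensional ℂ (trunc i n) :=
  FiniteDimensional.span_of_finite ℂ ((Set.finite_Iic n).image _)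

theorem bv_mem_trunc {k n : ℕ} (h : k ≤ n) : bv i k ∈ trunc i n :=
  Submodule.subset_span ⟨k, h, rfl⟩

theorem trunc_mono : Monotone (trunc i) := fun _ _ h =>
  Submodule.span_mono (Set.image_mono (Set.Iic_subset_Iic.mpr h))

theorem map_mem_of_mem_trunc {W : Type} [AddCommGroup W] [Module ℂ W] (f : LM i →ₗ[ℂ] W)
    {T : Submodule ℂ W} {n : ℕ} (h : ∀ k ≤ n, f (bv i k) ∈ T) {m : LM i} (hm : m ∈ trunc i n) :
    f m ∈ T := by
  have : trunc i n ≤ T.comap f := Submodule.span_le.mpr <| by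
    rintro _ ⟨k, hk, rfl⟩
    exact h k hk
  exact this hm

theorem E_smul_mem_trunc {m : LM i} {n : ℕ} (hm : m ∈ trunc i n) : E • m ∈ trunc i n := by
  change gen .E • m ∈ _
  rw [gen_smul]
  refine map_mem_of_mem_trunc (op i .E) (fun k hk => ?_) hm
  rw [op_E_bv]
  exact Submodule.smul_mem _ _ (bv_mem_trunc (by omega))

end LM

namespace ExtM

variable {i j : ℤ} {φ : Cocycle i j}

/-- The linear section of the projection. -/
def sec (φ : Cocycle i j) : LM i →ₗ[ℂ] ExtM φ :=
  show LM i →ₗ[ℂ] ExtM φ from LinearMap.inl ℂ (LM i) (LM j)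

/-- The inclusion as a map of vector spaces. -/
def inclL (φ : Cocycle i j) : LM j →ₗ[ℂ] ExtM φ :=
  show LM j →ₗ[ℂ] ExtM φ from LinearMap.inr ℂ (LM i) (LM j)

theorem inclL_apply (b : LM j) : inclL φ b = incl φ b := rfl

theorem proj_sec (m : LM i) : proj φ (sec φ m) = m := rfl

theorem proj_incl (b : LM j) : proj φ (incl φ b) = 0 := rfl

theorem incl_injective : Function.Injective (incl φ) := fun _ _ h => congrArg Prod.snd h

theorem gen_smul_sec (g : Gen) (m : LM i) :
    gen g • sec φ m = sec φ (gen g • m) + incl φ (φ.map g m) := by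
  rw [gen_smul]
  change ((gen g • m, gen g • (0 : LM j) + φ.map g m) : LM i × LM j) =
    (gen g • m + 0, 0 + φ.map g m)
  rw [smul_zero, add_zero]

theorem exists_eq (x : ExtM φ) : ∃ b, x = sec φ (proj φ x) + incl φ b :=
  ⟨x.2, Prod.ext (add_zero _).symm (zero_add _).symm⟩

theorem range_incl : LinearMap.range (incl φ) = LinearMap.ker (proj φ) := by
  ext x
  constructor
  · rintro ⟨b, rfl⟩
    exact proj_incl b
  · intro hx
    obtain ⟨b, hb⟩ := exists_eq x
    rw [LinearMap.mem_ker.mp hx, map_zero, zero_add] at hb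
    exact ⟨b, hb.symm⟩

theorem proj_surjective : Function.Surjective (proj φ) := fun m => ⟨sec φ m, proj_sec m⟩

instance : Module.Finite U (ExtM φ) := by
  refine ⟨Submodule.fg_of_fg_map_of_fg_inf_ker (proj φ) ?_ ?_⟩
  · rw [Submodule.map_top, LinearMap.range_eq_top.mpr proj_surjective]
    exact Module.Finite.fg_top
  · rw [top_inf_eq, ← range_incl, LinearMap.range_eq_map]
    exact Module.Finite.fg_top.map _

theorem exists_finiteDimensional (k : ℕ) : ∃ W : Submodule ℂ (ExtM φ), FiniteDimensional ℂ W ∧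
    sec φ (LM.bv i k) ∈ W ∧ incl φ (LM.bv j k) ∈ W ∧ (∀ x ∈ W, E • x ∈ W) ∧
    ∀ x ∈ W, P • x ∈ W := by
  obtain ⟨N, hN⟩ := φ.bound
  have hmono : ∀ l ≤ k, LM.trunc j (l + N) ≤ LM.trunc j (k + N) := fun l hl =>
    LM.trunc_mono (by omega)
  refine ⟨(LM.trunc i k).map (sec φ) ⊔ (LM.trunc j (k + N)).map (inclL φ), inferInstance,
    Submodule.mem_sup_left ⟨_, LM.bv_mem_trunc le_rfl, rfl⟩,
    Submodule.mem_sup_right ⟨_, LM.bv_mem_trunc (by omega), rfl⟩, fun x hx => ?_, fun x hx => ?_⟩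
  · obtain ⟨_, ⟨a, ha, rfl⟩, _, ⟨b, hb, rfl⟩, rfl⟩ := Submodule.mem_sup.mp hx
    rw [smul_add, inclL_apply, ← map_smul (incl φ), add_comm (E • _)]
    refine Submodule.add_mem _ (Submodule.mem_sup_right ⟨_, LM.E_smul_mem_trunc hb, rfl⟩) ?_
    change gen .E • _ ∈ _
    rw [gen_smul_sec]
    exact Submodule.add_mem_sup ⟨_, LM.E_smul_mem_trunc ha, rfl⟩
      ⟨_, LM.map_mem_of_mem_trunc φ.e (fun l hl => hmono l hl (hN l).1) ha, rfl⟩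
  · obtain ⟨_, ⟨a, ha, rfl⟩, _, ⟨b, hb, rfl⟩, rfl⟩ := Submodule.mem_sup.mp hx
    rw [smul_add, inclL_apply, ← map_smul (incl φ), LM.P_smul, map_zero, add_zero]
    change gen .P • _ ∈ _
    rw [gen_smul_sec]
    exact Submodule.add_mem_sup ⟨0, Submodule.zero_mem _, by rw [map_zero]; exact
      ((congrArg _ (LM.P_smul a)).trans (map_zero _)).symm⟩
      ⟨_, LM.map_mem_of_mem_trunc φ.p (fun l hl => hmono l hl (hN l).2) ha, rfl⟩

theorem inO : InO (ExtM φ) := by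
  refine inO_of_span (Set.range (sec φ ∘ LM.bv i) ∪ Set.range (inclL φ ∘ LM.bv j)) inferInstance
    ?_ ?_ ?_ ?_
  · rw [Submodule.span_union, Set.range_comp, Set.range_comp, ← Submodule.map_span,
      ← Submodule.map_span, LM.span_bv, LM.span_bv, eq_top_iff]
    intro x _
    obtain ⟨b, hb⟩ := exists_eq x
    rw [hb]
    exact Submodule.add_mem_sup ⟨_, trivial, rfl⟩ ⟨b, trivial, rfl⟩
  · rintro _ (⟨k, rfl⟩ | ⟨k, rfl⟩)
    · refine ⟨i - 2 * k, ?_⟩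
      have := gen_smul_sec (φ := φ) .H (LM.bv i k)
      have h0 : φ.map .H = 0 := rfl
      rw [h0, LinearMap.zero_apply, map_zero, add_zero] at this
      refine this.trans ?_
      change sec φ (H • LM.bv i k) = _
      rw [LM.H_smul_bv, map_smul]
      rfl
    · refine ⟨j - 2 * k, ?_⟩
      simp only [Function.comp_apply]
      rw [inclL_apply, ← map_smul (incl φ), LM.H_smul_bv, ← inclL_apply, map_smul]
      rfl
  · intro x
    have := gen_smul .Z x
    refine this.trans (Prod.ext (LM.Z_smul _) ?_)
    change Z • x.2 + (0 : LM i →ₗ[ℂ] LM j) x.1 = 0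
    rw [LM.Z_smul, LinearMap.zero_apply, add_zero]
  · rintro _ (⟨k, rfl⟩ | ⟨k, rfl⟩) <;>
    obtain ⟨W, hW, h1, h2, h3⟩ := exists_finiteDimensional (φ := φ) k
    · exact ⟨W, hW, h1, h3⟩
    · exact ⟨W, hW, h2, h3⟩

end ExtM

/-- The extension in category `O` attached to a cocycle. -/
def Cocycle.oExt {i j : ℤ} (φ : Cocycle i j) :
    OExt (ModuleCat.of U (LM i)) (ModuleCat.of U (LM j)) where
  X := ModuleCat.of U (ExtM φ)
  memO := ExtM.inO
  incl := ExtM.incl φ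
  proj := ExtM.proj φ
  inj := ExtM.incl_injective
  surj := ExtM.proj_surjective
  exact := ExtM.range_incl

/-- An extension of `LM i` by `LM j` with middle term a weight module `X`. -/
structure WExt (i j : ℤ) (X : Type) [AddCommGroup X] [Module U X] where
  incl : LM j →ₗ[U] X
  proj : X →ₗ[U] LM i
  inj : Function.Injective incl
  surj : Function.Surjective proj
  exact : LinearMap.range incl = LinearMap.ker proj
  weight (v : X) : v ∈ AddSubgroup.closure {w : X | ∃ hh zz : ℂ, IsWeightVec hh zz w}

namespace WExt

variable {i j : ℤ} {X : Type} [AddCommGroup X] [Module ℂ X] [Module U X] [IsScalarTower ℂ U X]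
  (T : WExt i j X) {φ : Cocycle i j}

omit [Module ℂ X] [IsScalarTower ℂ U X] in
theorem proj_incl (b : LM j) : T.proj (T.incl b) = 0 :=
  LinearMap.mem_ker.mp (T.exact ▸ LinearMap.mem_range_self T.incl b)

omit [Module ℂ X] [IsScalarTower ℂ U X] in
theorem exists_incl {x : X} (hx : T.proj x = 0) : ∃ b, T.incl b = x :=
  LinearMap.mem_range.mp (T.exact ▸ LinearMap.mem_ker.mpr hx)

theorem incl_smul (c : ℂ) (b : LM j) : T.incl (c • b) = c • T.incl b :=
  LinearMap.map_smul_of_tower _ c b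

theorem proj_smul (c : ℂ) (x : X) : T.proj (c • x) = c • T.proj x :=
  LinearMap.map_smul_of_tower _ c x

theorem exists_incl_of_H_smul {x : X} {μ : ℂ} (hx : T.proj x = 0) (hμ : H • x = μ • x) :
    ∃ b, T.incl b = x ∧ H • b = μ • b := by
  obtain ⟨b, rfl⟩ := T.exists_incl hx
  exact ⟨b, rfl, T.inj (by rw [map_smul, hμ, T.incl_smul])⟩

include T in
theorem Z_smul (x : X) : Z • x = 0 := by
  induction T.weight x using AddSubgroup.closure_induction with
  | mem w hw =>
    obtain ⟨_, ζ, -, hZ⟩ := hw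
    rw [sc_smul] at hZ
    have h0 : ζ • T.proj w = 0 := by rw [← T.proj_smul, ← hZ, map_smul, LM.Z_smul]
    rcases smul_eq_zero.mp h0 with h | h
    · rw [hZ, h, zero_smul]
    · obtain ⟨b, rfl⟩ := T.exists_incl h
      rw [← map_smul, LM.Z_smul, map_zero]
  | zero => exact smul_zero _
  | add x y _ _ hx hy => rw [smul_add, hx, hy, add_zero]
  | neg x _ hx => rw [smul_neg, hx, neg_zero]

theorem exists_lift : ∃ x : X, H • x = (i : ℂ) • x ∧ T.proj x = LM.bv i 0 := by
  have key : ∀ y : X, ∃ x : X, H • x = (i : ℂ) • x ∧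
      T.proj x = LM.coeff 0 (T.proj y) • LM.bv i 0 := by
    intro y
    induction T.weight y using AddSubgroup.closure_induction with
    | mem w hw =>
      obtain ⟨μ, _, hH, -⟩ := hw
      rw [sc_smul] at hH
      have hp : H • T.proj w = μ • T.proj w := by rw [← map_smul, hH, T.proj_smul]
      by_cases hμ : μ = i
      · subst hμ
        exact ⟨w, hH, LM.eq_coeff_smul_bv (by simpa using hp)⟩
      · refine ⟨0, by simp, ?_⟩
        have := LM.coeff_H_smul 0 (T.proj w)
        rw [hp, map_smul, smul_eq_mul] at this
        have h0 : (μ - i) * LM.coeff 0 (T.proj w) = 0 := by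
          push_cast at this
          linear_combination this
        rw [(mul_eq_zero.mp h0).resolve_left (sub_ne_zero.mpr hμ), zero_smul, map_zero]
    | zero => exact ⟨0, by simp, by simp⟩
    | add y y' _ _ hy hy' =>
      obtain ⟨x, hx, hx'⟩ := hy
      obtain ⟨z, hz, hz'⟩ := hy'
      exact ⟨x + z, by rw [smul_add, smul_add, hx, hz], by
        rw [map_add, map_add, map_add, add_smul, hx', hz']⟩
    | neg y _ hy =>
      obtain ⟨x, hx, hx'⟩ := hy
      exact ⟨-x, by rw [smul_neg, smul_neg, hx], by rw [map_neg, map_neg, map_neg, neg_smul, hx']⟩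
  obtain ⟨y, hy⟩ := T.surj (LM.bv i 0)
  obtain ⟨x, hx, hx'⟩ := key y
  refine ⟨x, hx, ?_⟩
  rw [hx', hy, LM.coeff_bv_self (LM.isIdx_zero i), one_smul]

/-- The linear section `s` of the projection realises the extension as `c` times the
extension given by the cocycle `φ`. -/
def Adapted (φ : Cocycle i j) (c : ℂ) (s : LM i →ₗ[ℂ] X) : Prop :=
  (∀ m, T.proj (s m) = m) ∧ ∀ g m, gen g • s m = s (gen g • m) + c • T.incl (φ.map g m)

variable {T}

theorem Adapted.exists_section {s : LM i →ₗ[ℂ] X} (hs : T.Adapted φ 0 s) :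
    ∃ s : LM i →ₗ[U] X, T.proj ∘ₗ s = LinearMap.id :=
  ⟨mkULinear s fun g m => by rw [hs.2, zero_smul, add_zero], LinearMap.ext hs.1⟩

/-- The comparison map attached to an adapted section. -/
def Adapted.hom {c : ℂ} {s : LM i →ₗ[ℂ] X} (hs : T.Adapted φ c s) : ExtM φ →ₗ[U] X :=
  mkULinear (show ExtM φ →ₗ[ℂ] X from
    LinearMap.coprod s (c • { T.incl with map_smul' := T.incl_smul })) fun g x => by
    rw [ExtM.gen_smul]
    change s (gen g • x.1) + c • T.incl (gen g • x.2 + φ.map g x.1) =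
      gen g • (s x.1 + c • T.incl x.2)
    rw [smul_add, hs.2, map_add, map_smul T.incl, smul_add, smul_comm (gen g) c]
    abel

theorem Adapted.hom_sec {c : ℂ} {s : LM i →ₗ[ℂ] X} (hs : T.Adapted φ c s) (m : LM i) :
    hs.hom (ExtM.sec φ m) = s m := by
  change s m + c • T.incl 0 = s m
  rw [map_zero, smul_zero, add_zero]

theorem Adapted.hom_incl {c : ℂ} {s : LM i →ₗ[ℂ] X} (hs : T.Adapted φ c s) (b : LM j) :
    hs.hom (ExtM.incl φ b) = c • T.incl b := by
  change s 0 + c • T.incl b = _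
  rw [map_zero, zero_add]

theorem Adapted.proj_hom {c : ℂ} {s : LM i →ₗ[ℂ] X} (hs : T.Adapted φ c s) (x : ExtM φ) :
    T.proj (hs.hom x) = ExtM.proj φ x := by
  obtain ⟨b, hb⟩ := ExtM.exists_eq x
  conv_lhs => rw [hb]
  rw [map_add, map_add, hs.hom_sec, hs.hom_incl, T.proj_smul, T.proj_incl, smul_zero, add_zero,
    hs.1]

theorem Adapted.hom_bijective {c : ℂ} {s : LM i →ₗ[ℂ] X} (hs : T.Adapted φ c s) (hc : c ≠ 0) :
    Function.Bijective hs.hom := by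
  refine ⟨(injective_iff_map_eq_zero _).mpr fun x hx => ?_, fun y => ?_⟩
  · obtain ⟨b, hb⟩ := ExtM.exists_eq x
    rw [← hs.proj_hom, hx, map_zero, map_zero, zero_add] at hb
    rw [hb, hs.hom_incl, ← T.incl_smul] at hx
    have : b = 0 := (smul_eq_zero.mp (T.inj (hx.trans (map_zero _).symm))).resolve_left hc
    rw [hb, this, map_zero]
  · obtain ⟨b, hb⟩ := T.exists_incl (x := y - s (T.proj y)) (by rw [map_sub, hs.1, sub_self])
    refine ⟨ExtM.sec φ (T.proj y) + ExtM.incl φ (c⁻¹ • b), ?_⟩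
    rw [map_add, hs.hom_sec, hs.hom_incl, T.incl_smul, smul_inv_smul₀ hc, hb]
    abel

variable (T)

theorem proj_lin {x : X} (hx : T.proj x = LM.bv i 0) (m : LM i) :
    T.proj (LM.lin (fun k => F ^ k • x) m) = m := by
  have : ({ T.proj with map_smul' := T.proj_smul } : X →ₗ[ℂ] LM i) ∘ₗ
      LM.lin (fun k => F ^ k • x) = LinearMap.id := LM.hom_ext fun k hk => by
    rw [LinearMap.comp_apply, LM.lin_bv hk]
    change T.proj _ = _
    rw [map_smul, hx, LM.F_pow_smul_bv, add_zero, LinearMap.id_apply]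
  exact LinearMap.congr_fun this m

/-- The section through a highest weight lift is adapted to a cocycle as soon as the defining
relations of the highest weight module are deformed accordingly. -/
theorem adapted_lin {x : X} (hH : H • x = (i : ℂ) • x) (hx : T.proj x = LM.bv i 0) (c : ℂ)
    {t u w : LM j} (hE : E • x = c • T.incl t) (hP : P • x = c • T.incl u)
    (hQ : Q • x = c • T.incl w)
    (hF : ∀ k, IsIdx i k → ¬ IsIdx i (k + 1) → F ^ (k + 1) • x = c • T.incl (φ.f (LM.bv i k)))
    (hφe : ∀ k, IsIdx i k → φ.e (LM.bv i k) = F ^ k • t)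
    (hφf : ∀ k, IsIdx i (k + 1) → φ.f (LM.bv i k) = 0)
    (hφp : ∀ k, IsIdx i k → φ.p (LM.bv i k) = F ^ k • u - (k : ℂ) • F ^ (k - 1) • w)
    (hφq : ∀ k, IsIdx i k → φ.q (LM.bv i k) = F ^ k • w) :
    T.Adapted φ c (LM.lin fun k => F ^ k • x) := by
  refine ⟨T.proj_lin hx, fun g m => ?_⟩
  set s : LM i →ₗ[ℂ] X := LM.lin fun k => F ^ k • x with hs
  have hsk : ∀ k, IsIdx i k → s (LM.bv i k) = F ^ k • x := fun k hk => LM.lin_bv hk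
  have hm : m ∈ Submodule.span ℂ (Set.range (LM.bv i)) := LM.span_bv ▸ Submodule.mem_top
  induction hm using Submodule.span_induction with
  | zero => simp
  | add m m' _ _ hm hm' =>
    rw [map_add, smul_add, hm, hm', smul_add, map_add, map_add, map_add, smul_add]
    abel
  | smul a m _ hm =>
    rw [map_smul s, smul_comm, hm, smul_comm (gen g), map_smul s, map_smul (φ.map g),
      T.incl_smul, smul_add, smul_comm a c]
  | mem _ h =>
    obtain ⟨k, rfl⟩ := h
    by_cases hk : IsIdx i k
    swap
    · simp [LM.bv_eq_zero hk]
    rw [hsk k hk]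
    cases g with
    | E =>
      change E • _ = s (E • _) + c • T.incl (φ.e _)
      rw [hφe k hk, map_smul T.incl, ← smul_comm (F ^ k) c, ← hE, LM.E_smul_bv, map_smul s]
      rcases k with _ | k
      · simp
      · rw [E_smul_F_pow_succ_smul hH, Nat.add_sub_cancel,
          hsk k (by unfold IsIdx at *; omega), add_comm]
        congr 2
        push_cast
        ring
    | F =>
      change F • _ = s (F • _) + c • T.incl (φ.f _)
      rw [LM.F_smul_bv, smul_smul, ← pow_succ']
      by_cases hk' : IsIdx i (k + 1)
      · rw [hφf k hk', map_zero, smul_zero, add_zero, hsk _ hk']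
      · rw [LM.bv_eq_zero hk', map_zero, zero_add, hF k hk hk']
    | H =>
      change H • _ = s (H • _) + c • T.incl 0
      rw [H_smul_F_pow_smul hH, LM.H_smul_bv, map_smul, hsk k hk, map_zero, smul_zero, add_zero]
    | P =>
      change P • _ = s (P • _) + c • T.incl (φ.p _)
      rw [LM.P_smul, map_zero, zero_add, P_smul_F_pow_smul, hP, hQ, hφp k hk, map_sub, T.incl_smul,
        map_smul, map_smul, smul_sub, smul_comm _ c, smul_comm _ c, smul_comm _ c]
    | Q =>
      change Q • _ = s (Q • _) + c • T.incl (φ.q _)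
      rw [LM.Q_smul, map_zero, zero_add, Q_smul_F_pow_smul, hQ, hφq k hk, map_smul, smul_comm]
    | Z =>
      change Z • _ = s (Z • _) + c • T.incl 0
      rw [T.Z_smul, LM.Z_smul, map_zero, map_zero, smul_zero, add_zero]

end WExt

/-- Transport of an extension along isomorphisms of its ends. -/
def OExt.congr {A B A' B' : ModuleCat.{0} U} (eA : A ≃ₗ[U] A') (eB : B ≃ₗ[U] B')
    (Ex : OExt A B) : OExt A' B' where
  X := Ex.X
  memO := Ex.memO
  incl := Ex.incl ∘ₗ eB.symm.toLinearMap
  proj := eA.toLinearMap ∘ₗ Ex.proj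
  inj := Ex.inj.comp eB.symm.injective
  surj := eA.surjective.comp Ex.surj
  exact := by
    rw [LinearMap.range_comp_of_range_eq_top _ (LinearEquiv.range _), Ex.exact,
      LinearEquiv.ker_comp]

theorem OExt.split_congr_iff {A B A' B' : ModuleCat.{0} U} (eA : A ≃ₗ[U] A') (eB : B ≃ₗ[U] B')
    (Ex : OExt A B) : (Ex.congr eA eB).Split ↔ Ex.Split := by
  constructor
  · rintro ⟨s, hs⟩
    refine ⟨s ∘ₗ eA.toLinearMap, LinearMap.ext fun a => eA.injective ?_⟩
    exact LinearMap.congr_fun hs (eA a)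
  · rintro ⟨s, hs⟩
    refine ⟨s ∘ₗ eA.symm.toLinearMap, LinearMap.ext fun a => ?_⟩
    exact (congrArg eA (LinearMap.congr_fun hs (eA.symm a))).trans (eA.apply_symm_apply a)

theorem ExtIsZero.congr {A B A' B' : ModuleCat.{0} U} (eA : A ≃ₗ[U] A') (eB : B ≃ₗ[U] B')
    (h : ExtIsZero A B) : ExtIsZero A' B' := fun Ex =>
  (Ex.split_congr_iff eA.symm eB.symm).mp (h _)

theorem ExtIsOneDimensional.congr {A B A' B' : ModuleCat.{0} U} (eA : A ≃ₗ[U] A')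
    (eB : B ≃ₗ[U] B') (h : ExtIsOneDimensional A B) : ExtIsOneDimensional A' B' := by
  obtain ⟨⟨Ex, hEx⟩, h⟩ := h
  refine ⟨⟨Ex.congr eA eB, fun hs => hEx ((Ex.split_congr_iff eA eB).mp hs)⟩,
    fun E1 E2 h1 h2 => ?_⟩
  obtain ⟨c, hc, ψ, hψ, hψ'⟩ := h (E1.congr eA.symm eB.symm) (E2.congr eA.symm eB.symm)
    (fun hs => h1 ((E1.split_congr_iff _ _).mp hs)) (fun hs => h2 ((E2.split_congr_iff _ _).mp hs))
  refine ⟨c, hc, ψ, fun b => ?_, fun x => eA.symm.injective (hψ' x)⟩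
  have := hψ (eB.symm b)
  change ψ (E1.incl (eB (eB.symm b))) = E2.incl (eB (sc c • eB.symm b)) at this
  rwa [map_smul, eB.apply_symm_apply] at this

theorem ExtIsOneDimensional.not_extIsZero {A B : ModuleCat.{0} U} (h : ExtIsOneDimensional A B) :
    ¬ ExtIsZero A B := fun h0 => by
  obtain ⟨Ex, hEx⟩ := h.1
  exact hEx (h0 Ex)

theorem isScalarTower_cmod (X : Type) [AddCommGroup X] [Module U X] :
    letI := cmod X
    IsScalarTower ℂ U X :=
  letI := cmod X
  ⟨fun c u x => by
    change (c • u) • x = algebraMap ℂ U c • u • x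
    rw [Algebra.smul_def, mul_smul]⟩

/-- An extension in category `O` of the concrete simple modules is a weight extension. -/
def OExt.toWExt {i j : ℤ} (Ex : OExt (ModuleCat.of U (LM i)) (ModuleCat.of U (LM j))) :
    WExt i j Ex.X where
  incl := Ex.incl
  proj := Ex.proj
  inj := Ex.inj
  surj := Ex.surj
  exact := Ex.exact
  weight := Ex.memO.2.1

theorem extIsZero_of_exists_section {i j : ℤ}
    (h : ∀ (X : Type) [AddCommGroup X] [Module ℂ X] [Module U X] [IsScalarTower ℂ U X]
      (T : WExt i j X), ∃ s : LM i →ₗ[U] X, T.proj ∘ₗ s = LinearMap.id) :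
    ExtIsZero (ModuleCat.of U (LM i)) (ModuleCat.of U (LM j)) := fun Ex => by
  let := cmod Ex.X
  have := isScalarTower_cmod Ex.X
  exact h Ex.X Ex.toWExt

theorem Cocycle.extIsOneDimensional {i j : ℤ} {φ : Cocycle i j}
    (h : ∀ (X : Type) [AddCommGroup X] [Module ℂ X] [Module U X] [IsScalarTower ℂ U X]
      (T : WExt i j X), ∃ c s, T.Adapted φ c s) (hφ : ¬ φ.oExt.Split) :
    ExtIsOneDimensional (ModuleCat.of U (LM i)) (ModuleCat.of U (LM j)) := by
  refine ⟨⟨φ.oExt, hφ⟩, fun E1 E2 h1 h2 => ?_⟩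
  have key : ∀ Ex : OExt (ModuleCat.of U (LM i)) (ModuleCat.of U (LM j)), ¬ Ex.Split →
      ∃ c : ℂ, c ≠ 0 ∧ ∃ Ψ : ExtM φ ≃ₗ[U] (Ex.X : Type),
        (∀ b, Ψ (ExtM.incl φ b) = Ex.incl (sc c • b)) ∧ ∀ x, Ex.proj (Ψ x) = ExtM.proj φ x := by
    intro Ex hEx
    let := cmod Ex.X
    have := isScalarTower_cmod Ex.X
    obtain ⟨c, s, hs⟩ := h Ex.X Ex.toWExt
    have hc : c ≠ 0 := by
      rintro rfl
      exact hEx hs.exists_section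
    refine ⟨c, hc, LinearEquiv.ofBijective hs.hom (hs.hom_bijective hc), fun b => ?_, hs.proj_hom⟩
    refine (hs.hom_incl b).trans ?_
    rw [map_smul, sc_smul]
    rfl
  obtain ⟨c₁, hc₁, Ψ₁, hi₁, hp₁⟩ := key E1 h1
  obtain ⟨c₂, hc₂, Ψ₂, hi₂, hp₂⟩ := key E2 h2
  refine ⟨c₂ / c₁, div_ne_zero hc₂ hc₁, Ψ₁.symm.trans Ψ₂, fun b => ?_, fun x => ?_⟩
  · have hb : E1.incl b = Ψ₁ (ExtM.incl φ (sc c₁⁻¹ • b)) := by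
      rw [hi₁, smul_smul, sc, sc, ← map_mul, mul_inv_cancel₀ hc₁, map_one, one_smul]
    rw [LinearEquiv.trans_apply, hb, LinearEquiv.symm_apply_apply, hi₂, smul_smul, sc, sc, sc,
      ← map_mul, div_eq_mul_inv]
  · rw [LinearEquiv.trans_apply, hp₂, ← hp₁, LinearEquiv.apply_symm_apply]

namespace Cocycle

open LM

variable {i j : ℤ}

/-- The trivial cocycle. -/
def zero (i j : ℤ) : Cocycle i j where
  e := 0
  f := 0
  p := 0
  q := 0
  he := by simp
  ef := by simp
  hf := by simp
  eq := by simp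
  ep := by simp
  hp := by simp
  fp := by simp
  fq := by simp
  hq := by simp
  bound := ⟨0, fun k => by simp⟩

/-- The action of `p` in the extension of `LM i` by `LM (i - 1)`. -/
def lowerP (i : ℤ) : LM i →ₗ[ℂ] LM (i - 1) := lin fun k => (k : ℂ) • bv (i - 1) (k - 1)

/-- The action of `q` in the extension of `LM i` by `LM (i - 1)`. -/
def lowerQ (i : ℤ) : LM i →ₗ[ℂ] LM (i - 1) := lin fun k => -bv (i - 1) k

theorem lowerP_bv (hi : i ≠ 0) (k : ℕ) : lowerP i (bv i k) = (k : ℂ) • bv (i - 1) (k - 1) := by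
  refine lin_bv_of_forall (w := fun k : ℕ => (k : ℂ) • bv (i - 1) (k - 1)) (fun k hk => ?_) k
  rw [bv_eq_zero, smul_zero]
  unfold IsIdx at *
  omega

theorem lowerQ_bv (hi : i ≠ 0) (k : ℕ) : lowerQ i (bv i k) = -bv (i - 1) k := by
  refine lin_bv_of_forall (w := fun k : ℕ => -bv (i - 1) k) (fun k hk => ?_) k
  rw [bv_eq_zero, neg_zero]
  unfold IsIdx at *
  omega

/-- The cocycle of the nonsplit extension of `LM i` by `LM (i - 1)`. -/
def lower (hi : i ≠ 0) : Cocycle i (i - 1) where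
  e := 0
  f := 0
  p := lowerP i
  q := lowerQ i
  he := by simp
  ef := by simp
  hf := by simp
  eq := hom_ext fun k _ => by
    simp only [LinearMap.comp_apply, LinearMap.add_apply, lowerP_bv hi, lowerQ_bv hi, map_neg,
      op_E_bv, map_smul]
    push_cast
    module
  ep := hom_ext fun k _ => by
    rcases k with _ | k
    · simp [lowerP_bv hi, op_E_bv]
    · simp only [LinearMap.comp_apply, lowerP_bv hi, op_E_bv, map_smul, Nat.add_sub_cancel]
      push_cast
      module
  hp := hom_ext fun k _ => by
    rcases k with _ | k
    · simp [lowerP_bv hi, op_H_bv]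
    · simp only [LinearMap.comp_apply, LinearMap.add_apply, lowerP_bv hi, op_H_bv, map_smul,
        Nat.add_sub_cancel]
      push_cast
      module
  fp := hom_ext fun k _ => by
    rcases k with _ | k
    · simp [lowerP_bv hi, lowerQ_bv hi, op_F_bv]
    · simp only [LinearMap.comp_apply, LinearMap.add_apply, lowerP_bv hi, lowerQ_bv hi, op_F_bv,
        map_smul, Nat.add_sub_cancel]
      push_cast
      module
  fq := hom_ext fun k _ => by
    simp only [LinearMap.comp_apply, lowerQ_bv hi, op_F_bv, map_neg]
  hq := hom_ext fun k _ => by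
    simp only [LinearMap.comp_apply, LinearMap.sub_apply, lowerQ_bv hi, op_H_bv, map_neg,
      map_smul]
    push_cast
    module
  bound := ⟨0, fun k => ⟨by simp, by
    rw [lowerP_bv hi]
    exact Submodule.smul_mem _ _ (bv_mem_trunc (by omega))⟩⟩

/-- The action of `p` in the extension of `LM i` by `LM (i + 1)`. -/
def raiseP (i : ℤ) : LM i →ₗ[ℂ] LM (i + 1) := lin fun k => (i + 1 - k : ℂ) • bv (i + 1) k

/-- The action of `q` in the extension of `LM i` by `LM (i + 1)`. -/
def raiseQ (i : ℤ) : LM i →ₗ[ℂ] LM (i + 1) := lin fun k => bv (i + 1) (k + 1)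

theorem raiseP_bv (k : ℕ) : raiseP i (bv i k) = (i + 1 - k : ℂ) • bv (i + 1) k := by
  refine lin_bv_of_forall (w := fun k : ℕ => (i + 1 - k : ℂ) • bv (i + 1) k) (fun k hk => ?_) k
  by_cases h : IsIdx (i + 1) k
  · have : (k : ℤ) = i + 1 := by unfold IsIdx at *; omega
    have : (k : ℂ) = i + 1 := by exact_mod_cast this
    rw [this, sub_self, zero_smul]
  · rw [bv_eq_zero h, smul_zero]

theorem raiseQ_bv (k : ℕ) : raiseQ i (bv i k) = bv (i + 1) (k + 1) := by
  refine lin_bv_of_forall (w := fun k : ℕ => bv (i + 1) (k + 1)) (fun k hk => bv_eq_zero ?_) k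
  unfold IsIdx at *
  omega

/-- The cocycle of the nonsplit extension of `LM i` by `LM (i + 1)`. -/
def raise (i : ℤ) : Cocycle i (i + 1) where
  e := 0
  f := 0
  p := raiseP i
  q := raiseQ i
  he := by simp
  ef := by simp
  hf := by simp
  eq := hom_ext fun k _ => by
    rcases k with _ | k
    · simp only [LinearMap.comp_apply, LinearMap.add_apply, raiseP_bv, raiseQ_bv, op_E_bv,
        map_smul]
      push_cast
      module
    · simp only [LinearMap.comp_apply, LinearMap.add_apply, raiseP_bv, raiseQ_bv, op_E_bv,
        map_smul, Nat.add_sub_cancel]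
      push_cast
      module
  ep := hom_ext fun k _ => by
    rcases k with _ | k
    · simp [raiseP_bv, op_E_bv]
    · simp only [LinearMap.comp_apply, raiseP_bv, op_E_bv, map_smul, Nat.add_sub_cancel]
      push_cast
      module
  hp := hom_ext fun k _ => by
    simp only [LinearMap.comp_apply, LinearMap.add_apply, raiseP_bv, op_H_bv, map_smul]
    push_cast
    module
  fp := hom_ext fun k _ => by
    simp only [LinearMap.comp_apply, LinearMap.add_apply, raiseP_bv, raiseQ_bv, op_F_bv, map_smul]
    push_cast
    module
  fq := hom_ext fun k _ => by
    simp only [LinearMap.comp_apply, raiseQ_bv, op_F_bv]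
  hq := hom_ext fun k _ => by
    simp only [LinearMap.comp_apply, LinearMap.sub_apply, raiseQ_bv, op_H_bv, map_smul]
    push_cast
    module
  bound := ⟨0, fun k => ⟨by simp, by
    rw [raiseP_bv]
    exact Submodule.smul_mem _ _ (bv_mem_trunc (by omega))⟩⟩

/-- The action of `f` in the extension of `LM i` by `LM (-i - 2)`, `0 ≤ i`. -/
def reflF (i : ℤ) : LM i →ₗ[ℂ] LM (-i - 2) :=
  lin fun k => if (k : ℤ) = i then bv (-i - 2) 0 else 0

theorem reflF_bv (k : ℕ) : reflF i (bv i k) = if (k : ℤ) = i then bv (-i - 2) 0 else 0 := by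
  refine lin_bv_of_forall (w := fun k : ℕ => if (k : ℤ) = i then bv (-i - 2) 0 else 0)
    (fun k hk => if_neg ?_) k
  unfold IsIdx at hk
  omega

/-- The cocycle of the nonsplit extension of `LM i` by `LM (-i - 2)`, `0 ≤ i`. -/
def reflOfNonneg (i : ℤ) : Cocycle i (-i - 2) where
  e := 0
  f := reflF i
  p := 0
  q := 0
  he := by simp
  ef := hom_ext fun k hk => by
    simp only [LinearMap.comp_apply, LinearMap.add_apply, reflF_bv, op_E_bv, map_smul,
      LinearMap.zero_apply, map_zero, zero_add, add_zero]
    rcases k with _ | k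
    · split_ifs <;> simp [op_E_bv]
    · rw [if_neg (c := ((k + 1 - 1 : ℕ) : ℤ) = i) (by unfold IsIdx at hk; omega), smul_zero]
      split_ifs <;> simp [op_E_bv]
  hf := hom_ext fun k hk => by
    simp only [LinearMap.comp_apply, LinearMap.sub_apply, LinearMap.smul_apply, reflF_bv, op_H_bv,
      map_smul]
    split_ifs with h
    · have : (k : ℂ) = i := by exact_mod_cast h
      rw [op_H_bv, this]
      push_cast
      module
    · simp
  eq := by simp
  ep := by simp
  hp := by simp
  fp := by simp
  fq := by simp
  hq := by simp
  bound := ⟨0, fun k => by simp⟩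

/-- The action of `e` in the extension of `LM i` by `LM (-i - 2)`, `i ≤ -2`. -/
def reflE (i : ℤ) : LM i →ₗ[ℂ] LM (-i - 2) := lin fun k => bv (-i - 2) ((-i - 2).toNat + k)

theorem reflE_bv (hi : i ≤ -2) (k : ℕ) :
    reflE i (bv i k) = bv (-i - 2) ((-i - 2).toNat + k) :=
  lin_bv (Or.inl (by omega))

/-- The cocycle of the nonsplit extension of `LM i` by `LM (-i - 2)`, `i ≤ -2`. -/
def reflOfNeg (hi : i ≤ -2) : Cocycle i (-i - 2) where
  e := reflE i
  f := 0
  p := 0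
  q := 0
  he := hom_ext fun k hk => by
    simp only [LinearMap.comp_apply, LinearMap.add_apply, LinearMap.smul_apply, reflE_bv hi,
      op_H_bv, map_smul]
    have h : (((-i - 2).toNat : ℤ) : ℂ) = ((-i - 2 : ℤ) : ℂ) := by
      rw [Int.toNat_of_nonneg (by omega)]
    rw [Int.cast_natCast] at h
    rw [Nat.cast_add, h]
    push_cast
    module
  ef := hom_ext fun k hk => by
    simp [reflE_bv hi, op_F_bv, add_assoc]
  hf := by simp
  eq := by simp
  ep := by simp
  hp := by simp
  fp := by simp
  fq := by simp
  hq := by simp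
  bound := ⟨(-i - 2).toNat, fun k => ⟨by
    rw [reflE_bv hi]
    exact bv_mem_trunc (by omega), by simp⟩⟩

end Cocycle

theorem LM.eq_zero_of_H_smul_intCast {i n : ℤ} {m : LM i} (hm : H • m = (n : ℂ) • m)
    (h : ∀ k : ℕ, IsIdx i k → n ≠ i - 2 * k) : m = 0 :=
  LM.eq_zero_of_H_smul hm fun k hk h0 => h k hk (by exact_mod_cast h0)

theorem LM.eq_smul_bv_of_H_smul_intCast {i n : ℤ} {m : LM i} (hm : H • m = (n : ℂ) • m) (k : ℕ)
    (h : n = i - 2 * k) : ∃ c : ℂ, m = c • LM.bv i k :=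
  ⟨_, LM.eq_coeff_smul_bv (hm.trans (by rw [h]; push_cast; rfl))⟩

namespace WExt

variable {i j : ℤ} {X : Type} [AddCommGroup X] [Module ℂ X] [Module U X] [IsScalarTower ℂ U X]
  (T : WExt i j X)

theorem eq_zero_of_H_smul {n : ℤ} {x : X} (hp : T.proj x = 0) (hx : H • x = (n : ℂ) • x)
    (h : ∀ k : ℕ, IsIdx j k → n ≠ j - 2 * k) : x = 0 := by
  obtain ⟨b, rfl, hb⟩ := T.exists_incl_of_H_smul hp hx
  rw [LM.eq_zero_of_H_smul_intCast hb h, map_zero]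

theorem exists_eq_smul_incl_bv {n : ℤ} {x : X} (hp : T.proj x = 0) (hx : H • x = (n : ℂ) • x)
    (k : ℕ) (h : n = j - 2 * k) : ∃ c : ℂ, x = c • T.incl (LM.bv j k) := by
  obtain ⟨b, rfl, hb⟩ := T.exists_incl_of_H_smul hp hx
  obtain ⟨c, rfl⟩ := LM.eq_smul_bv_of_H_smul_intCast hb k h
  exact ⟨c, T.incl_smul _ _⟩

/-- A lift of the highest weight vector satisfying its defining relations gives a section. -/
theorem exists_section {x : X} (hH : H • x = (i : ℂ) • x) (hx : T.proj x = LM.bv i 0)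
    (hE : E • x = 0) (hP : P • x = 0) (hQ : Q • x = 0)
    (hF : ∀ k, IsIdx i k → ¬ IsIdx i (k + 1) → F ^ (k + 1) • x = 0) :
    ∃ s : LM i →ₗ[U] X, T.proj ∘ₗ s = LinearMap.id :=
  Adapted.exists_section (φ := .zero i j) (T.adapted_lin (t := 0) (u := 0) (w := 0) hH hx 0
    (by simpa using hE) (by simpa using hP) (by simpa using hQ)
    (fun k hk hk' => by simpa using hF k hk hk') (fun k _ => by simp [Cocycle.zero])
    (fun k _ => by simp [Cocycle.zero]) (fun k _ => by simp [Cocycle.zero])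
    (fun k _ => by simp [Cocycle.zero]))

omit [Module ℂ X] [IsScalarTower ℂ U X] in
theorem proj_P (x : X) : T.proj (P • x) = 0 := by rw [map_smul, LM.P_smul]

omit [Module ℂ X] [IsScalarTower ℂ U X] in
theorem proj_Q (x : X) : T.proj (Q • x) = 0 := by rw [map_smul, LM.Q_smul]

section Lift

variable {x : X} (hH : H • x = (i : ℂ) • x) (hx : T.proj x = LM.bv i 0)

include hH in
theorem H_smul_E : H • E • x = ((i + 2 : ℤ) : ℂ) • E • x := by
  simpa using H_smul_E_smul hH

include hH in
theorem H_smul_P : H • P • x = ((i + 1 : ℤ) : ℂ) • P • x := by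
  simpa using H_smul_P_smul hH

include hH in
theorem H_smul_Q : H • Q • x = ((i - 1 : ℤ) : ℂ) • Q • x := by
  simpa using H_smul_Q_smul hH

include hH in
theorem H_smul_F_pow_succ (k : ℕ) :
    H • F ^ (k + 1) • x = ((i - 2 * (k + 1) : ℤ) : ℂ) • F ^ (k + 1) • x := by
  simpa using H_smul_F_pow_smul hH (k + 1)

include T hH in
theorem P_smul_eq_zero (h : ∀ k : ℕ, IsIdx j k → i + 1 ≠ j - 2 * k) : P • x = 0 :=
  T.eq_zero_of_H_smul (T.proj_P x) (H_smul_P hH) h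

include T hH in
theorem Q_smul_eq_zero (h : ∀ k : ℕ, IsIdx j k → i - 1 ≠ j - 2 * k) : Q • x = 0 :=
  T.eq_zero_of_H_smul (T.proj_Q x) (H_smul_Q hH) h

variable {T}

include hx

omit [Module ℂ X] [IsScalarTower ℂ U X] in
theorem proj_E : T.proj (E • x) = 0 := by rw [map_smul, hx, LM.E_smul_bv]; simp

omit [Module ℂ X] [IsScalarTower ℂ U X] in
theorem proj_F_pow_succ {k : ℕ} (hk : ¬ IsIdx i (k + 1)) : T.proj (F ^ (k + 1) • x) = 0 := by
  rw [map_smul, hx, LM.F_pow_smul_bv, add_zero, LM.bv_eq_zero hk]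

include hH

theorem E_smul_eq_zero (h : ∀ k : ℕ, IsIdx j k → i + 2 ≠ j - 2 * k) : E • x = 0 :=
  T.eq_zero_of_H_smul (proj_E hx) (H_smul_E hH) h

theorem F_pow_smul_eq_zero (h : ∀ k l : ℕ, i - 2 * (k + 1) ≠ j - 2 * l) (k : ℕ)
    (hk : ¬ IsIdx i (k + 1)) : F ^ (k + 1) • x = 0 :=
  T.eq_zero_of_H_smul (proj_F_pow_succ hx hk) (H_smul_F_pow_succ hH k) fun l _ => h k l

end Lift

theorem exists_adapted_lower (hi : i ≠ 0) (T : WExt i (i - 1) X) :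
    ∃ c s, T.Adapted (.lower hi) c s := by
  obtain ⟨x, hH, hx⟩ := T.exists_lift
  obtain ⟨c, hc⟩ := T.exists_eq_smul_incl_bv (T.proj_Q x) (H_smul_Q hH) 0 (by simp)
  refine ⟨-c, _, T.adapted_lin (t := 0) (u := 0) (w := -LM.bv (i - 1) 0) hH hx (-c) ?_ ?_ ?_ ?_
    (fun k _ => ?_) (fun k _ => ?_) (fun k _ => ?_) (fun k _ => ?_)⟩
  · rw [E_smul_eq_zero hH hx (by omega), map_zero, smul_zero]
  · rw [T.P_smul_eq_zero hH (by omega), map_zero, smul_zero]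
  · rw [hc, map_neg, smul_neg, neg_smul, neg_neg]
  · intro k _ hk
    rw [F_pow_smul_eq_zero hH hx (by omega) k hk]
    simp [Cocycle.lower]
  · simp [Cocycle.lower]
  · simp [Cocycle.lower]
  · simp [Cocycle.lower, Cocycle.lowerP_bv hi, LM.F_pow_smul_bv]
  · simp [Cocycle.lower, Cocycle.lowerQ_bv hi, LM.F_pow_smul_bv]

theorem exists_adapted_raise (T : WExt i (i + 1) X) : ∃ c s, T.Adapted (.raise i) c s := by
  obtain ⟨x, hH, hx⟩ := T.exists_lift
  obtain ⟨c, hc⟩ := T.exists_eq_smul_incl_bv (T.proj_Q x) (H_smul_Q hH) 1 (by push_cast; ring)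
  have hE : E • x = 0 := E_smul_eq_zero hH hx (by omega)
  refine ⟨c, _, T.adapted_lin (t := 0) (u := (i + 1 : ℂ) • LM.bv (i + 1) 0)
    (w := LM.bv (i + 1) 1) hH hx c ?_ ?_ hc ?_
    (fun k _ => ?_) (fun k _ => ?_) (fun k _ => ?_) (fun k _ => ?_)⟩
  · rw [hE, map_zero, smul_zero]
  · have : E • Q • x = Q • E • x + P • x := by rw [smul_smul, E_mul_Q, add_smul, mul_smul]
    rw [hE, smul_zero, zero_add, hc, smul_comm, ← map_smul T.incl E, LM.E_smul_bv] at this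
    rw [← this]
    simp
  · intro k _ hk
    rw [F_pow_smul_eq_zero hH hx (by omega) k hk]
    simp [Cocycle.raise]
  · simp [Cocycle.raise]
  · simp [Cocycle.raise]
  · change Cocycle.raiseP i _ = _
    rw [Cocycle.raiseP_bv, smul_comm, LM.F_pow_smul_bv, LM.F_pow_smul_bv, add_zero]
    rcases k with _ | k
    · simp
    · rw [Nat.add_sub_cancel]
      module
  · change Cocycle.raiseQ i _ = _
    rw [Cocycle.raiseQ_bv, LM.F_pow_smul_bv]

theorem exists_adapted_reflOfNonneg (hi : 0 ≤ i) (T : WExt i (-i - 2) X) :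
    ∃ c s, T.Adapted (.reflOfNonneg i) c s := by
  obtain ⟨x, hH, hx⟩ := T.exists_lift
  have hi' : (i.toNat : ℤ) = i := Int.toNat_of_nonneg hi
  obtain ⟨c, hc⟩ := T.exists_eq_smul_incl_bv
    (proj_F_pow_succ hx (k := i.toNat) (by unfold IsIdx; omega)) (H_smul_F_pow_succ hH _) 0
    (by rw [hi']; push_cast; ring)
  refine ⟨c, _, T.adapted_lin (t := 0) (u := 0) (w := 0) hH hx c ?_ ?_ ?_ ?_
    (fun k _ => ?_) (fun k hk => ?_) (fun k _ => ?_) (fun k _ => ?_)⟩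
  · rw [E_smul_eq_zero hH hx (by omega), map_zero, smul_zero]
  · rw [T.P_smul_eq_zero hH (by omega), map_zero, smul_zero]
  · rw [T.Q_smul_eq_zero hH (by omega), map_zero, smul_zero]
  · intro k hk hk'
    obtain rfl : k = i.toNat := by unfold IsIdx at *; omega
    rw [hc]
    change _ = c • T.incl (Cocycle.reflF i _)
    rw [Cocycle.reflF_bv, if_pos hi']
  · simp [Cocycle.reflOfNonneg]
  · change Cocycle.reflF i _ = _
    rw [Cocycle.reflF_bv, if_neg (by unfold IsIdx at hk; omega)]
  · simp [Cocycle.reflOfNonneg]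
  · simp [Cocycle.reflOfNonneg]

theorem exists_adapted_reflOfNeg (hi : i ≤ -2) (T : WExt i (-i - 2) X) :
    ∃ c s, T.Adapted (.reflOfNeg hi) c s := by
  obtain ⟨x, hH, hx⟩ := T.exists_lift
  obtain ⟨c, hc⟩ := T.exists_eq_smul_incl_bv (proj_E hx) (H_smul_E hH) (-i - 2).toNat
    (by omega)
  refine ⟨c, _, T.adapted_lin (t := LM.bv (-i - 2) (-i - 2).toNat) (u := 0) (w := 0) hH hx c
    hc ?_ ?_ ?_ (fun k _ => ?_) (fun k _ => ?_) (fun k _ => ?_) (fun k _ => ?_)⟩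
  · rw [T.P_smul_eq_zero hH (by omega), map_zero, smul_zero]
  · rw [T.Q_smul_eq_zero hH (by omega), map_zero, smul_zero]
  · intro k _ hk
    exact (hk (Or.inl (by omega))).elim
  · change Cocycle.reflE i _ = _
    rw [Cocycle.reflE_bv hi, LM.F_pow_smul_bv, add_comm]
  · simp [Cocycle.reflOfNeg]
  · simp [Cocycle.reflOfNeg]
  · simp [Cocycle.reflOfNeg]

theorem exists_section_of_odd (hij : Odd (i - j)) (h1 : j = i - 1 → i = 0)
    (h2 : j = i + 1 → j = 0) : ∃ s : LM i →ₗ[U] X, T.proj ∘ₗ s = LinearMap.id := by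
  obtain ⟨d, hd⟩ := hij
  obtain ⟨x, hH, hx⟩ := T.exists_lift
  have hE : E • x = 0 := E_smul_eq_zero hH hx (by omega)
  have hF := F_pow_smul_eq_zero hH hx (by omega)
  have hEQ : E • Q • x = P • x := by rw [smul_smul, E_mul_Q, add_smul, mul_smul, hE, smul_zero,
    zero_add]
  have hEP : E • P • x = 0 := by rw [smul_smul, E_mul_P, mul_smul, hE, smul_zero]
  have hhw : ∀ {n : ℤ} {y : X}, T.proj y = 0 → H • y = (n : ℂ) • y → E • y = 0 → n ≠ j →
      y = 0 := by
    intro n y hp hn hEy hne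
    obtain ⟨b, rfl, hb⟩ := T.exists_incl_of_H_smul hp hn
    have hEb : E • b = 0 := T.inj (by rw [map_smul, hEy, map_zero])
    have hb' := LM.eq_smul_bv_zero_of_E_smul hEb
    have h0 : (n : ℂ) • b = (j : ℂ) • b := by
      rw [← hb, hb', smul_comm, LM.H_smul_bv, smul_comm]
      simp
    rw [← sub_eq_zero, ← sub_smul] at h0
    rw [(smul_eq_zero.mp h0).resolve_left (sub_ne_zero.mpr (by exact_mod_cast hne)), map_zero]
  have hP : P • x = 0 := by
    by_cases hj : j = i + 1
    · rw [← hEQ, T.Q_smul_eq_zero hH, smul_zero]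
      intro k hk
      have := h2 hj
      unfold IsIdx at hk
      omega
    · exact hhw (T.proj_P x) (H_smul_P hH) hEP (Ne.symm hj)
  have hQ : Q • x = 0 := by
    by_cases hj : j = i - 1
    · have h := P_smul_F_pow_smul x (0 + 1)
      rw [hF 0 (by unfold IsIdx; have := h1 hj; omega), hP] at h
      simpa using h
    · exact hhw (T.proj_Q x) (H_smul_Q hH) (hEQ.trans hP) (Ne.symm hj)
  exact T.exists_section hH hx hE hP hQ fun k _ hk => hF k hk

theorem exists_section_of_even (hij : Even (i - j)) (h1 : j ≠ i) (h2 : j ≠ -i - 2) :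
    ∃ s : LM i →ₗ[U] X, T.proj ∘ₗ s = LinearMap.id := by
  obtain ⟨d, hd⟩ := hij
  obtain ⟨x, hH, hx⟩ := T.exists_lift
  set a : ℂ := i * (i + 2) - j * (j + 2) with ha
  have ha0 : a ≠ 0 := by
    have : a = ((i - j : ℤ) : ℂ) * ((i + j + 2 : ℤ) : ℂ) := by push_cast; ring
    rw [this]
    exact mul_ne_zero (Int.cast_ne_zero.mpr (by omega)) (Int.cast_ne_zero.mpr (by omega))
  set C : U := casimir - algebraMap ℂ U (j * (j + 2)) with hC
  have hcomm : ∀ {u : U}, u * casimir = casimir * u → ∀ y : X, u • C • y = C • u • y := by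
    intro u hu y
    rw [smul_smul, smul_smul, hC, mul_sub, sub_mul, hu, Algebra.commutes]
  have hC0 : ∀ y : X, T.proj y = 0 → C • y = 0 := by
    intro y hy
    obtain ⟨b, rfl⟩ := T.exists_incl hy
    rw [← map_smul, hC, sub_smul, LM.casimir_smul, algebraMap_smul, sub_self, map_zero]
  have hCH : H • C • x = (i : ℂ) • C • x := by rw [hcomm H_mul_casimir, hH, smul_comm]
  have hCp : T.proj (C • x) = a • LM.bv i 0 := by
    rw [map_smul, hx, hC, sub_smul, LM.casimir_smul, algebraMap_smul, ← sub_smul]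
  have hH' : H • a⁻¹ • C • x = (i : ℂ) • a⁻¹ • C • x := by
    rw [smul_comm, hCH, smul_comm]
  have hx' : T.proj (a⁻¹ • C • x) = LM.bv i 0 := by
    rw [T.proj_smul, hCp, inv_smul_smul₀ ha0]
  refine T.exists_section hH' hx' ?_ (T.P_smul_eq_zero hH' (by omega))
    (T.Q_smul_eq_zero hH' (by omega)) fun k _ hk => ?_
  · rw [smul_comm, hcomm E_mul_casimir, hC0 _ (proj_E hx), smul_zero]
  · have hFk : F ^ (k + 1) * casimir = casimir * F ^ (k + 1) :=
      Commute.pow_left F_mul_casimir (k + 1)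
    rw [smul_comm, hcomm hFk, hC0 _ (proj_F_pow_succ hx hk), smul_zero]

end WExt

theorem Cocycle.map_bv_eq_zero_of_split {i j : ℤ} {φ : Cocycle i j} (h : φ.oExt.Split) {k : ℕ}
    (hk : ∀ l : ℕ, IsIdx j l → i - 2 * k ≠ j - 2 * l) {g : Gen} (hg : gen g • LM.bv i k = 0) :
    φ.map g (LM.bv i k) = 0 := by
  obtain ⟨s, hs⟩ := h
  change LM i →ₗ[U] ExtM φ at s
  change ExtM.proj φ ∘ₗ s = LinearMap.id at hs
  obtain ⟨b, hb⟩ := ExtM.exists_eq (s (LM.bv i k))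
  have hp : ExtM.proj φ (s (LM.bv i k)) = LM.bv i k := LinearMap.congr_fun hs _
  rw [hp] at hb
  have hH : H • s (LM.bv i k) = ((i - 2 * k : ℤ) : ℂ) • s (LM.bv i k) := by
    rw [← map_smul, LM.H_smul_bv, LinearMap.map_smul_of_tower]
    push_cast
    rfl
  have hsec : H • ExtM.sec φ (LM.bv i k) = ((i - 2 * k : ℤ) : ℂ) • ExtM.sec φ (LM.bv i k) := by
    have := ExtM.gen_smul_sec (φ := φ) .H (LM.bv i k)
    have h0 : φ.map .H = 0 := rfl
    rw [h0, LinearMap.zero_apply, map_zero, add_zero] at this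
    refine this.trans ?_
    change ExtM.sec φ (H • LM.bv i k) = _
    rw [LM.H_smul_bv, LinearMap.map_smul]
    push_cast
    rfl
  have hbH : H • b = ((i - 2 * k : ℤ) : ℂ) • b := ExtM.incl_injective (φ := φ) <| by
    rw [hb, smul_add, smul_add, hsec, add_right_inj] at hH
    rw [map_smul, hH, LinearMap.map_smul_of_tower]
  rw [LM.eq_zero_of_H_smul_intCast hbH hk, map_zero, add_zero] at hb
  have := ExtM.gen_smul_sec (φ := φ) g (LM.bv i k)
  rw [← hb, ← map_smul, hg, map_zero, map_zero, zero_add] at this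
  exact ExtM.incl_injective (this.symm.trans (map_zero _).symm)

theorem LM.extIsOneDimensional {i j : ℤ} (hij : i ≠ j)
    (h : (j = i - 1 ∧ i ≠ 0) ∨ (j = i + 1 ∧ j ≠ 0) ∨ j = -i - 2) :
    ExtIsOneDimensional (ModuleCat.of U (LM i)) (ModuleCat.of U (LM j)) := by
  rcases h with ⟨rfl, hi⟩ | ⟨rfl, hi⟩ | rfl
  · refine Cocycle.extIsOneDimensional
      (fun X _ _ _ _ T => WExt.exists_adapted_lower hi T) fun hs => ?_
    have h0 : Cocycle.lowerQ i (LM.bv i 0) = 0 :=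
      Cocycle.map_bv_eq_zero_of_split hs (g := .Q) (by omega) (LM.Q_smul _)
    rw [Cocycle.lowerQ_bv hi, neg_eq_zero] at h0
    exact LM.bv_ne_zero (LM.isIdx_zero _) h0
  · refine Cocycle.extIsOneDimensional
      (fun X _ _ _ _ T => WExt.exists_adapted_raise T) fun hs => ?_
    have h0 : Cocycle.raiseP i (LM.bv i 0) = 0 :=
      Cocycle.map_bv_eq_zero_of_split hs (g := .P) (by omega) (LM.P_smul _)
    rw [Cocycle.raiseP_bv, Nat.cast_zero, sub_zero] at h0
    exact smul_ne_zero (by exact_mod_cast hi) (LM.bv_ne_zero (LM.isIdx_zero _)) h0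
  · rcases le_or_gt 0 i with hi | hi
    · have hi' : (i.toNat : ℤ) = i := Int.toNat_of_nonneg hi
      refine Cocycle.extIsOneDimensional
        (fun X _ _ _ _ T => WExt.exists_adapted_reflOfNonneg hi T) fun hs => ?_
      have h0 : Cocycle.reflF i (LM.bv i i.toNat) = 0 :=
        Cocycle.map_bv_eq_zero_of_split hs (g := .F) (by omega)
          ((LM.F_smul_bv _).trans (LM.bv_eq_zero (by unfold IsIdx; omega)))
      rw [Cocycle.reflF_bv, if_pos hi'] at h0
      exact LM.bv_ne_zero (LM.isIdx_zero _) h0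
    · have hi' : i ≤ -2 := by omega
      refine Cocycle.extIsOneDimensional
        (fun X _ _ _ _ T => WExt.exists_adapted_reflOfNeg hi' T) fun hs => ?_
      have h0 : Cocycle.reflE i (LM.bv i 0) = 0 :=
        Cocycle.map_bv_eq_zero_of_split hs (g := .E) (fun l hl => by unfold IsIdx at hl; omega)
          ((LM.E_smul_bv 0).trans (by simp))
      rw [Cocycle.reflE_bv hi'] at h0
      exact LM.bv_ne_zero (by unfold IsIdx; omega) h0

theorem LM.extIsZero {i j : ℤ} (hij : i ≠ j)
    (h : ¬ ((j = i - 1 ∧ i ≠ 0) ∨ (j = i + 1 ∧ j ≠ 0) ∨ j = -i - 2)) :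
    ExtIsZero (ModuleCat.of U (LM i)) (ModuleCat.of U (LM j)) := by
  refine extIsZero_of_exists_section fun X _ _ _ _ T => ?_
  rcases Int.even_or_odd (i - j) with he | ho
  · exact T.exists_section_of_even he hij.symm (by tauto)
  · exact T.exists_section_of_odd ho (by tauto) (by tauto)

theorem extIsOneDimensional_Lmod {i j : ℤ} (hij : i ≠ j)
    (h : (j = i - 1 ∧ i ≠ 0) ∨ (j = i + 1 ∧ j ≠ 0) ∨ j = -i - 2) :
    ExtIsOneDimensional (Lmod i) (Lmod j) :=
  (LM.extIsOneDimensional hij h).congr (simpleHWEquiv i).symm (simpleHWEquiv j).symm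

theorem extIsZero_Lmod {i j : ℤ} (hij : i ≠ j)
    (h : ¬ ((j = i - 1 ∧ i ≠ 0) ∨ (j = i + 1 ∧ j ≠ 0) ∨ j = -i - 2)) :
    ExtIsZero (Lmod i) (Lmod j) :=
  (LM.extIsZero hij h).congr (simpleHWEquiv i).symm (simpleHWEquiv j).symm

/-- from the proof of Proposition 16 of the paper: in the
integral block of zero central charge, for `i, j ∈ ℤ` with `i > j` one has
`Ext¹_O(L(i·h✓), L(j·h✓)) ≅ ℂ` if `(i ≠ 0 ∧ j = i - 1)` or
`(i ≥ 0 ∧ j = -i - 2)`, and `Ext¹_O(L(i·h✓), L(j·h✓)) = 0` otherwise; moreover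
`Ext¹_O(L(i·h✓), L(j·h✓)) ≅ Ext¹_O(L(j·h✓), L(i·h✓))` for all `i, j ∈ ℤ`. -/
theorem ext_between_simples_integral_zero_charge :
    (∀ i j : ℤ, j < i →
      (((i ≠ 0 ∧ j = i - 1) ∨ (0 ≤ i ∧ j = -i - 2)) →
          ExtIsOneDimensional (Lmod i) (Lmod j)) ∧
      (¬ ((i ≠ 0 ∧ j = i - 1) ∨ (0 ≤ i ∧ j = -i - 2)) →
          ExtIsZero (Lmod i) (Lmod j))) ∧
    (∀ i j : ℤ,
      (ExtIsZero (Lmod i) (Lmod j) ↔ ExtIsZero (Lmod j) (Lmod i)) ∧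
      (ExtIsOneDimensional (Lmod i) (Lmod j) ↔
        ExtIsOneDimensional (Lmod j) (Lmod i))) := by
  refine ⟨fun i j hij => ⟨fun h => extIsOneDimensional_Lmod (by omega) (by omega),
    fun h => extIsZero_Lmod (by omega) (by omega)⟩, fun i j => ?_⟩
  rcases eq_or_ne i j with rfl | hij
  · exact ⟨Iff.rfl, Iff.rfl⟩
  by_cases h : (j = i - 1 ∧ i ≠ 0) ∨ (j = i + 1 ∧ j ≠ 0) ∨ j = -i - 2
  · have h1 := extIsOneDimensional_Lmod hij h
    have h2 := extIsOneDimensional_Lmod (i := j) (j := i) hij.symm (by omega)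
    exact ⟨iff_of_false h1.not_extIsZero h2.not_extIsZero, iff_of_true h1 h2⟩
  · have h1 := extIsZero_Lmod hij h
    have h2 := extIsZero_Lmod (i := j) (j := i) hij.symm (by omega)
    exact ⟨iff_of_true h1 h2, iff_of_false (fun h0 => h0.not_extIsZero h1)
      fun h0 => h0.not_extIsZero h2⟩

end

end Schrodinger
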